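/- arXiv:2601.15692 — 3 statements merged into one kernel-verified Lean document; each statement's English description precedes it below -/
import Mathlib

section
/- Let K be a field and a, b, c pairwise coprime positive integers. Suppose f is a negative curve, i.e., f is an irreducible homogeneous element of [𝔭_K(a,b,c)^{(r0)}]_{d0} with d0/r0 < √(abc). Then f ∉ 𝔭_K(a,b,c)^{(r0+1)}; in particular, the integer r0 attached to the negative curve is uniquely determined. -/
open MvPolynomial

noncomputable section

/-- The weight function assigning degrees `a, b, c` to the variables `x, y, z`. -/
def wt (a b c : ℕ) : Fin 3 → ℕ := ![a, b, c]

/-- The `K`-algebra map `K[x,y,z] → K[T]`, `x ↦ T^a`, `y ↦ T^b`, `z ↦ T^c`. -/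
def toPoly (K : Type*) [CommRing K] (a b c : ℕ) :
    MvPolynomial (Fin 3) K →ₐ[K] Polynomial K :=
  aeval ![Polynomial.X ^ a, Polynomial.X ^ b, Polynomial.X ^ c]

/-- The space monomial prime `𝔭_K(a,b,c)`. -/
def pIdeal (K : Type*) [CommRing K] (a b c : ℕ) : Ideal (MvPolynomial (Fin 3) K) :=
  RingHom.ker (toPoly K a b c)

instance pIdeal_isPrime (K : Type*) [Field K] (a b c : ℕ) : (pIdeal K a b c).IsPrime :=
  RingHom.ker_isPrime _

/-- The `n`-th symbolic power `Q^{(n)} = Q^n A_Q ∩ A` of a prime ideal. -/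
def symbPow {A : Type*} [CommRing A] (Q : Ideal A) [Q.IsPrime] (n : ℕ) : Ideal A :=
  Ideal.comap (algebraMap A (Localization.AtPrime Q))
    (Ideal.map (algebraMap A (Localization.AtPrime Q)) (Q ^ n))

/-- The symbolic Rees algebra `A[Qt, Q^{(2)}t^2, …] ⊆ A[t]`. -/
def symbolicRees {A : Type*} [CommRing A] (Q : Ideal A) [Q.IsPrime] :
    Subalgebra A (Polynomial A) :=
  Algebra.adjoin A
    (⋃ n : ℕ, (fun p => Polynomial.C p * Polynomial.X ^ n) '' ((symbPow Q n : Ideal A) : Set A))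

/-- The degree-`d` homogeneous component `[J]_d` of an ideal `J ⊆ K[x,y,z]`,
as a `K`-subspace. -/
def gpiece (K : Type*) [CommRing K] (a b c : ℕ) (J : Ideal (MvPolynomial (Fin 3) K))
    (d : ℕ) : Submodule K (MvPolynomial (Fin 3) K) :=
  (Submodule.restrictScalars K J) ⊓ (weightedHomogeneousSubmodule K (wt a b c) d)

end

/-- If a nonzero polynomial has all its exponents in one residue class modulo `c`, where `c` is
invertible in `K`, and vanishes to order `N` at `1`, then its degree is at least `c * N`. -/
lemma Polynomial.mul_le_natDegree_of_support_modEq {K : Type*} [Field K] {q : Polynomial K}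
    (hq : q ≠ 0) {c i₀ N : ℕ} (hc : (c : K) ≠ 0) (hs : ∀ i, q.coeff i ≠ 0 → i ≡ i₀ [MOD c])
    (h : (Polynomial.X - Polynomial.C 1) ^ N ∣ q) : c * N ≤ q.natDegree := by
  have hc0 : 0 < c := Nat.pos_of_ne_zero (by rintro rfl; simp at hc)
  obtain ⟨q', hq'⟩ : Polynomial.X ^ (i₀ % c) ∣ q := by
    rw [Polynomial.X_pow_dvd_iff]
    intro d hd
    by_contra hne
    have h1 := hs d hne
    have h2 : d % c = i₀ % c := h1
    have := Nat.mod_le d c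
    omega
  have hk : q' = Polynomial.expand K c (Polynomial.contract c q') := by
    ext i
    rw [Polynomial.coeff_expand hc0]
    split_ifs with hdvd
    · rw [Polynomial.coeff_contract hc0.ne', Nat.div_mul_cancel hdvd]
    · by_contra hne
      have h1 : q.coeff (i + i₀ % c) = q'.coeff i := by
        rw [hq', Polynomial.coeff_X_pow_mul]
      have h2 := hs (i + i₀ % c) (by rwa [h1])
      have h3 : i + i₀ % c ≡ 0 + i₀ % c [MOD c] := by
        simpa using h2.trans (Nat.mod_modEq i₀ c).symm
      exact hdvd ((Nat.modEq_zero_iff_dvd).1 (Nat.ModEq.add_right_cancel' _ h3))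
  set k := Polynomial.contract c q' with hkdef
  have hq'0 : q' ≠ 0 := by rintro rfl; simp at hq'; exact hq hq'
  have hk0 : k ≠ 0 := by intro h0; rw [h0] at hk; simp at hk; exact hq'0 hk
  obtain ⟨k₁, hk₁, hnd⟩ := Polynomial.exists_eq_pow_rootMultiplicity_mul_and_not_dvd k hk0 1
  set M := Polynomial.rootMultiplicity 1 k with hM
  have hprime : Prime (Polynomial.X - Polynomial.C (1 : K)) := Polynomial.prime_X_sub_C 1
  have hgeom : (Polynomial.X : Polynomial K) ^ c - 1 =
      (Polynomial.X - Polynomial.C 1) * ∑ i ∈ Finset.range c, Polynomial.X ^ i := by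
    rw [Polynomial.C_1, mul_comm, geom_sum_mul]
  have hqfac : q = (Polynomial.X - Polynomial.C 1) ^ M *
      (Polynomial.X ^ (i₀ % c) * (∑ i ∈ Finset.range c, Polynomial.X ^ i) ^ M *
        Polynomial.expand K c k₁) := by
    have : Polynomial.expand K c k = ((Polynomial.X : Polynomial K) ^ c - 1) ^ M *
        Polynomial.expand K c k₁ := by
      conv_lhs => rw [hk₁]
      simp
    rw [hq', hk, this, hgeom, mul_pow]
    ring
  have hNM : N ≤ M := by
    by_contra hlt
    push Not at hlt
    have hd : (Polynomial.X - Polynomial.C (1 : K)) ∣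
        (Polynomial.X ^ (i₀ % c) * (∑ i ∈ Finset.range c, Polynomial.X ^ i) ^ M *
        Polynomial.expand K c k₁) := by
      have h1 : (Polynomial.X - Polynomial.C (1 : K)) ^ (M + 1) ∣ q :=
        (pow_dvd_pow _ hlt).trans h
      rw [hqfac, pow_succ] at h1
      exact (mul_dvd_mul_iff_left (pow_ne_zero _ hprime.ne_zero)).1 h1
    rw [Polynomial.dvd_iff_isRoot] at hd hnd
    apply hnd
    simpa [Polynomial.IsRoot, Polynomial.eval_finsetSum, Polynomial.expand_eval, hc] using hd
  have hdeg : q.natDegree = i₀ % c + k.natDegree * c := by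
    rw [hq', Polynomial.natDegree_X_pow_mul _ hq'0, hk, Polynomial.natDegree_expand, add_comm]
  have hMk : M ≤ k.natDegree := by
    classical
    rw [hM, ← Polynomial.count_roots]
    exact (Multiset.count_le_card _ _).trans (Polynomial.card_roots' k)
  rw [hdeg]
  linarith [Nat.mul_le_mul_right c (hNM.trans hMk), Nat.zero_le (i₀ % c), mul_comm c N]

/-- The maximal ideal of the point all of whose coordinates are `1`. -/
noncomputable def onePointIdeal (σ K : Type*) [CommRing K] : Ideal (MvPolynomial σ K) :=
  RingHom.ker (MvPolynomial.eval (fun _ : σ => (1 : K)))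

/-- The multiplicity at `(1, 1)` of a nonzero weighted homogeneous bivariate polynomial with
coprime weights, bounded in terms of its degree; here `w l` is assumed invertible in `K`. -/
lemma mul_le_of_mem_onePointIdeal_pow_aux {K : Type*} [Field K] {w : Fin 2 → ℕ} {k l : Fin 2}
    (hw : Nat.Coprime (w l) (w k)) {h : MvPolynomial (Fin 2) K} (h0 : h ≠ 0)
    {D : ℤ} (hD : ∀ e, h.coeff e ≠ 0 → (e k * w k + e l * w l : ℤ) = D)
    (hkl : ∀ i, i = k ∨ i = l) (hk0 : 0 < w k) (hl0 : 0 < w l)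
    (hl : (w l : K) ≠ 0) {N : ℕ} (hN : h ∈ onePointIdeal (Fin 2) K ^ N) :
    (w k * w l * N : ℤ) ≤ D := by
  classical
  set φ : MvPolynomial (Fin 2) K →ₐ[K] Polynomial K :=
    aeval (fun i => if i = k then Polynomial.X else 1) with hφ
  have hne : k ≠ l := by
    rintro rfl
    have := hkl 0
    have := hkl 1
    omega
  have hmon : φ h = ∑ e ∈ h.support, Polynomial.monomial (e k) (h.coeff e) := by
    conv_lhs => rw [h.as_sum]
    rw [map_sum]
    refine Finset.sum_congr rfl fun e _ => ?_
    rw [hφ, aeval_monomial, Finsupp.prod_fintype _ _ (by simp),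
      Finset.prod_eq_single_of_mem k (Finset.mem_univ _)]
    · simp [Polynomial.C_mul_X_pow_eq_monomial]
    · intro b _ hb
      simp [hb]
  have hinj : ∀ e ∈ h.support, ∀ e' ∈ h.support, e k = e' k → e = e' := by
    intro e he e' he' hee
    have h1 := hD e (mem_support_iff.1 he)
    have h2 := hD e' (mem_support_iff.1 he')
    have h3 : (e l : ℤ) * w l = e' l * w l := by rw [hee] at h1; linarith
    have h4 : e l = e' l := by
      have : (w l : ℤ) ≠ 0 := by exact_mod_cast hl0.ne'
      exact_mod_cast mul_right_cancel₀ this h3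
    ext i
    rcases hkl i with rfl | rfl
    · exact hee
    · exact h4
  have hcoeff : ∀ e ∈ h.support, (φ h).coeff (e k) = h.coeff e := by
    intro e he
    rw [hmon, Polynomial.finsetSum_coeff, Finset.sum_eq_single_of_mem e he]
    · simp
    · intro e' he' hne'
      rw [Polynomial.coeff_monomial, if_neg]
      exact fun hh => hne' (hinj e' he' e he hh)
  have hex : ∀ i, (φ h).coeff i ≠ 0 → ∃ e ∈ h.support, e k = i := by
    intro i hi
    rw [hmon, Polynomial.finsetSum_coeff] at hi
    obtain ⟨e, he, hne'⟩ := Finset.exists_ne_zero_of_sum_ne_zero hi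
    refine ⟨e, he, ?_⟩
    by_contra hh
    rw [Polynomial.coeff_monomial, if_neg hh] at hne'
    exact hne' rfl
  obtain ⟨e₀, he₀⟩ := support_nonempty.2 h0
  have hq0 : φ h ≠ 0 := by
    intro hz
    have := hcoeff e₀ he₀
    rw [hz] at this
    exact mem_support_iff.1 he₀ (by simpa using this.symm)
  have hdvd : (Polynomial.X - Polynomial.C 1) ^ N ∣ φ h := by
    have hle : (onePointIdeal (Fin 2) K).map φ ≤
        Ideal.span {Polynomial.X - Polynomial.C (1 : K)} := by
      rw [Ideal.map_le_iff_le_comap]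
      intro p hp
      rw [Ideal.mem_comap, Ideal.mem_span_singleton, Polynomial.dvd_iff_isRoot]
      have hp' : MvPolynomial.eval (fun _ => (1 : K)) p = 0 := hp
      have hcomp : (Polynomial.evalRingHom (1 : K)).comp
          (φ : MvPolynomial (Fin 2) K →+* Polynomial K) =
          MvPolynomial.eval (fun _ => (1 : K)) := by
        apply MvPolynomial.ringHom_ext
        · intro r; simp [hφ]
        · intro i
          by_cases hi : i = k <;> simp [hφ, hi]
      have := RingHom.congr_fun hcomp p
      simpa [hp'] using this
    have hm : φ h ∈ (onePointIdeal (Fin 2) K ^ N).map φ := Ideal.mem_map_of_mem _ hN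
    rw [Ideal.map_pow] at hm
    have := Ideal.pow_right_mono hle N hm
    rwa [Ideal.span_singleton_pow, Ideal.mem_span_singleton] at this
  have key := Polynomial.mul_le_natDegree_of_support_modEq hq0 (i₀ := e₀ k) hl ?_ hdvd
  · obtain ⟨e, he, hek⟩ := hex (φ h).natDegree (by simpa using hq0)
    have h1 := hD e (mem_support_iff.1 he)
    rw [← hek] at key
    have h2 : (w l * N : ℤ) ≤ e k := by exact_mod_cast key
    have h3 : (0 : ℤ) ≤ e l * w l := by positivity
    nlinarith [mul_le_mul_of_nonneg_left h2 (show (0 : ℤ) ≤ w k by positivity)]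
  · intro i hi
    obtain ⟨e, he, rfl⟩ := hex i hi
    have h1 := hD e (mem_support_iff.1 he)
    have h2 := hD e₀ (mem_support_iff.1 he₀)
    apply Nat.ModEq.cancel_right_of_coprime (c := w k) hw
    rw [← Int.natCast_modEq_iff, Int.modEq_iff_dvd]
    push_cast
    exact ⟨e l - e₀ l, by linarith⟩

/-- A nonzero weighted homogeneous bivariate polynomial with coprime weights `b`, `c` which vanishes
to order `N` at `(1, 1)` has degree at least `b * c * N`. -/
lemma mul_le_of_mem_onePointIdeal_pow {K : Type*} [Field K] {b c : ℕ} (hb : 0 < b) (hc : 0 < c)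
    (hbc : Nat.Coprime b c) {h : MvPolynomial (Fin 2) K} (h0 : h ≠ 0)
    {D : ℤ} (hD : h.IsWeightedHomogeneous ![(b : ℤ), (c : ℤ)] D) {N : ℕ}
    (hN : h ∈ onePointIdeal (Fin 2) K ^ N) : (b * c * N : ℤ) ≤ D := by
  have hD' : ∀ e, h.coeff e ≠ 0 → (e 0 * b + e 1 * c : ℤ) = D := by
    intro e he
    have := hD he
    simpa [Finsupp.weight_apply, Finsupp.sum_fintype, Fin.sum_univ_two] using this
  by_cases hcK : (c : K) = 0
  · have hbK : (b : K) ≠ 0 := by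
      intro hbK
      have h1 := congrArg (Int.cast (R := K)) (Nat.gcd_eq_gcd_ab b c)
      rw [hbc.gcd_eq_one] at h1
      push_cast at h1
      simp [hbK, hcK] at h1
    have := mul_le_of_mem_onePointIdeal_pow_aux (w := ![b, c]) (k := 1) (l := 0)
      (by simpa using hbc) h0 (D := D)
      (fun e he => by simpa [add_comm] using hD' e he) (by decide) (by simpa) (by simpa)
      (by simpa) hN
    simpa [mul_comm (c : ℤ)] using this
  · have := mul_le_of_mem_onePointIdeal_pow_aux (w := ![b, c]) (k := 0) (l := 1)
      (by simpa using hbc.symm) h0 (D := D)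
      (fun e he => by simpa using hD' e he) (by decide) (by simpa) (by simpa)
      (by simpa) hN
    simpa using this

/-- Expanding a polynomial vanishing to order `r` at the point `(1, …, 1)` around `x₀ = 1`, the
`i`-th coefficient vanishes to order `r - i`. -/
lemma taylor_finSuccEquiv_coeff_mem {K : Type*} [CommRing K] {n : ℕ} (r : ℕ) :
    ∀ f ∈ onePointIdeal (Fin (n + 1)) K ^ r, ∀ i,
      ((finSuccEquiv K n f).taylor 1).coeff i ∈ onePointIdeal (Fin n) K ^ (r - i) := by
  induction r with
  | zero => intro f _ i; simp
  | succ r ih =>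
    intro f hf
    rw [pow_succ] at hf
    refine Submodule.mul_induction_on hf ?_ ?_
    · intro u hu v hv i
      rw [map_mul, Polynomial.taylor_mul, Polynomial.coeff_mul]
      refine Ideal.sum_mem _ fun x hx => ?_
      have hx' := Finset.HasAntidiagonal.mem_antidiagonal.1 hx
      have hv' : ((finSuccEquiv K n v).taylor 1).coeff x.2 ∈
          onePointIdeal (Fin n) K ^ (1 - x.2) := by
        rcases Nat.eq_zero_or_pos x.2 with h0 | h0
        · rw [h0, Polynomial.taylor_coeff_zero, Nat.sub_zero, pow_one]
          have hv0 : MvPolynomial.eval (fun _ => (1 : K)) v = 0 := hv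
          have hcomp : (MvPolynomial.eval (fun _ => (1 : K))).comp
              ((Polynomial.evalRingHom (1 : MvPolynomial (Fin n) K)).comp
                (finSuccEquiv K n : MvPolynomial (Fin (n + 1)) K →+* _)) =
              MvPolynomial.eval (fun _ => (1 : K)) := by
            apply MvPolynomial.ringHom_ext
            · intro r; simp [finSuccEquiv_apply]
            · intro i
              refine Fin.cases ?_ (fun j => ?_) i
              · simp [finSuccEquiv_X_zero]
              · simp [finSuccEquiv_X_succ]
          have := RingHom.congr_fun hcomp v
          rw [hv0] at this
          exact this
        · rw [Nat.sub_eq_zero_of_le h0]; simp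
      have hmul := Ideal.mul_mem_mul (ih u hu x.1) hv'
      rw [← pow_add] at hmul
      exact Ideal.pow_le_pow_right (by omega) hmul
    · intro u v hu hv i
      rw [map_add, map_add, Polynomial.coeff_add]
      exact Ideal.add_mem _ (hu i) (hv i)

/-- The coefficients of a weighted homogeneous trivariate polynomial, seen as a polynomial in its
first variable, are weighted homogeneous. -/
lemma isWeightedHomogeneous_finSuccEquiv_coeff {K : Type*} [CommRing K] {a b c d : ℕ}
    {f : MvPolynomial (Fin 3) K} (hf : f.IsWeightedHomogeneous (wt a b c) d) (i : ℕ) :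
    ((finSuccEquiv K 2 f).coeff i).IsWeightedHomogeneous ![(b : ℤ), (c : ℤ)] (d - a * i) := by
  intro e he
  rw [finSuccEquiv_coeff_coeff] at he
  have := hf he
  simp only [Finsupp.weight_apply, Finsupp.sum_fintype, zero_smul, implies_true,
    Fin.sum_univ_succ, wt] at this ⊢
  simp [Finsupp.cons_zero, Finsupp.cons_succ] at this ⊢
  have h2 := congrArg (Nat.cast (R := ℤ)) this
  push_cast at h2
  have h3 : Finsupp.cons i e 1 = e 0 := Finsupp.cons_succ (0 : Fin 2) i e
  have h4 : Finsupp.cons i e 2 = e 1 := Finsupp.cons_succ (1 : Fin 2) i e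
  rw [h3, h4] at h2
  linarith

lemma two_mul_sum_tsub (k M : ℕ) (h : k ≤ M) :
    2 * ∑ i ∈ Finset.range M, (k - i) = k * (k + 1) := by
  induction k generalizing M with
  | zero => simp
  | succ k ih =>
    obtain ⟨M, rfl⟩ : ∃ M', M = M' + 1 := ⟨M - 1, by omega⟩
    rw [Finset.sum_range_succ']
    simp only [Nat.add_sub_add_right, Nat.sub_zero, mul_add, ih M (by omega)]
    ring

/-- The combinatorial estimate behind the multiplicity bound for Sylvester determinants. -/
lemma mul_le_sum_tsub_perm {m n r s : ℕ} (hr : r ≤ m) (hs : s ≤ n) (σ : Equiv.Perm (Fin (m + n))) :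
    r * s ≤ ∑ j : Fin m, (s + j - (σ (Fin.castAdd n j) : ℕ)) +
      ∑ j : Fin n, (r + j - (σ (Fin.natAdd m j) : ℕ)) := by
  have h1 : ∑ i : Fin (m + n), (r + s - (i : ℕ)) =
      ∑ j : Fin m, (r + s - (σ (Fin.castAdd n j) : ℕ)) +
      ∑ j : Fin n, (r + s - (σ (Fin.natAdd m j) : ℕ)) := by
    rw [← Fin.sum_univ_add (fun j => (r + s - (σ j : ℕ)))]
    exact (Equiv.sum_comp σ (fun i : Fin (m + n) => (r + s - (i : ℕ)))).symm
  have h2 : ∑ j : Fin m, (r + s - (σ (Fin.castAdd n j) : ℕ)) ≤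
      ∑ j : Fin m, (s + j - (σ (Fin.castAdd n j) : ℕ)) + ∑ j : Fin m, (r - (j : ℕ)) := by
    rw [← Finset.sum_add_distrib]
    exact Finset.sum_le_sum fun j _ => by omega
  have h3 : ∑ j : Fin n, (r + s - (σ (Fin.natAdd m j) : ℕ)) ≤
      ∑ j : Fin n, (r + j - (σ (Fin.natAdd m j) : ℕ)) + ∑ j : Fin n, (s - (j : ℕ)) := by
    rw [← Finset.sum_add_distrib]
    exact Finset.sum_le_sum fun j _ => by omega
  have t1 := two_mul_sum_tsub (r + s) (m + n) (by omega)
  have t2 := two_mul_sum_tsub r m hr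
  have t3 := two_mul_sum_tsub s n hs
  rw [← Fin.sum_univ_eq_sum_range (fun i => r + s - i)] at t1
  rw [← Fin.sum_univ_eq_sum_range (fun i => r - i)] at t2
  rw [← Fin.sum_univ_eq_sum_range (fun i => s - i)] at t3
  nlinarith

/-- If the coefficients of `F` and `G` lie in decreasing powers of an ideal `I`, then their
resultant lies in a correspondingly large power of `I`. -/
lemma resultant_mem_pow {R : Type*} [CommRing R] (I : Ideal R) {F G : Polynomial R} {m n r s : ℕ}
    (hF : ∀ i, F.coeff i ∈ I ^ (r - i)) (hG : ∀ i, G.coeff i ∈ I ^ (s - i)) :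
    F.resultant G m n ∈
      I ^ (n * (r - min r m) + m * (s - min s n) + min r m * min s n) := by
  rw [Polynomial.resultant, Matrix.det_apply]
  refine Ideal.sum_mem _ fun σ _ => ?_
  rw [Units.smul_def, zsmul_eq_mul]
  refine Ideal.mul_mem_left _ _ ?_
  rw [Fin.prod_univ_add]
  have hA : ∏ j : Fin m, F.sylvester G m n (σ (Fin.castAdd n j)) (Fin.castAdd n j) ∈
      I ^ ∑ j : Fin m, ((s - min s n) + (min s n + j - (σ (Fin.castAdd n j) : ℕ))) := by
    rw [← Finset.prod_pow_eq_pow_sum]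
    refine Ideal.prod_mem_prod fun j _ => ?_
    simp only [Polynomial.sylvester, Matrix.of_apply, Fin.addCases_left, Set.mem_Icc]
    split_ifs with h
    · exact Ideal.pow_le_pow_right (by omega) (hG _)
    · exact Ideal.zero_mem _
  have hB : ∏ j : Fin n, F.sylvester G m n (σ (Fin.natAdd m j)) (Fin.natAdd m j) ∈
      I ^ ∑ j : Fin n, ((r - min r m) + (min r m + j - (σ (Fin.natAdd m j) : ℕ))) := by
    rw [← Finset.prod_pow_eq_pow_sum]
    refine Ideal.prod_mem_prod fun j _ => ?_
    simp only [Polynomial.sylvester, Matrix.of_apply, Fin.addCases_right, Set.mem_Icc]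
    split_ifs with h
    · exact Ideal.pow_le_pow_right (by omega) (hF _)
    · exact Ideal.zero_mem _
  have hAB := Ideal.mul_mem_mul hA hB
  rw [← pow_add] at hAB
  refine Ideal.pow_le_pow_right ?_ hAB
  have := mul_le_sum_tsub_perm (min_le_right r m) (min_le_right s n) σ
  simp only [Finset.sum_add_distrib, Finset.sum_const, Finset.card_univ, Fintype.card_fin,
    smul_eq_mul] at this ⊢
  linarith

/-- The resultant of polynomials with suitably homogeneous coefficients is homogeneous. -/
lemma resultant_isWeightedHomogeneous {K τ : Type*} [CommRing K] {w : τ → ℤ}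
    {F G : Polynomial (MvPolynomial τ K)} {a d e : ℤ} {m n : ℕ}
    (hF : ∀ i : ℕ, (F.coeff i).IsWeightedHomogeneous w (d - a * i))
    (hG : ∀ i : ℕ, (G.coeff i).IsWeightedHomogeneous w (e - a * i)) :
    (F.resultant G m n).IsWeightedHomogeneous w (n * d + m * e - a * m * n) := by
  rw [Polynomial.resultant, Matrix.det_apply]
  refine IsWeightedHomogeneous.sum _ _ _ fun σ _ => ?_
  rw [Units.smul_def, ← mem_weightedHomogeneousSubmodule]
  refine zsmul_mem ?_ _
  rw [mem_weightedHomogeneousSubmodule]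
  have hprod := IsWeightedHomogeneous.prod (w := w) Finset.univ
    (fun j => F.sylvester G m n (σ j) j)
    (fun j => Fin.addCases (motive := fun _ => ℤ) (fun j₁ : Fin m => e - a * ((σ j : ℕ) - j₁))
      (fun j₁ : Fin n => d - a * ((σ j : ℕ) - j₁)) j) ?_
  · convert hprod using 1
    rw [Fin.sum_univ_add]
    simp only [Fin.addCases_left, Fin.addCases_right, Finset.sum_sub_distrib, ← Finset.mul_sum,
      Finset.sum_const, Finset.card_univ, Fintype.card_fin, nsmul_eq_mul]
    have h1 : ∑ i : Fin (m + n), ((i : ℕ) : ℤ) = ∑ j : Fin m, ((σ (Fin.castAdd n j) : ℕ) : ℤ) +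
        ∑ j : Fin n, ((σ (Fin.natAdd m j) : ℕ) : ℤ) := by
      rw [← Fin.sum_univ_add (fun j => ((σ j : ℕ) : ℤ))]
      exact (Equiv.sum_comp σ (fun i : Fin (m + n) => ((i : ℕ) : ℤ))).symm
    rw [Fin.sum_univ_add] at h1
    simp only [Fin.val_castAdd, Fin.val_natAdd, Nat.cast_add, Finset.sum_add_distrib,
      Finset.sum_const, Finset.card_univ, Fintype.card_fin, nsmul_eq_mul] at h1
    linear_combination (-a) * h1
  · intro j _
    induction j using Fin.addCases with
    | left j =>
      simp only [Polynomial.sylvester, Matrix.of_apply, Fin.addCases_left, Set.mem_Icc]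
      split_ifs with h
      · have := hG (σ (Fin.castAdd n j) - j)
        rwa [Nat.cast_sub h.1] at this
      · exact isWeightedHomogeneous_zero _ _ _
    | right j =>
      simp only [Polynomial.sylvester, Matrix.of_apply, Fin.addCases_right, Set.mem_Icc]
      split_ifs with h
      · have := hF (σ (Fin.natAdd m j) - j)
        rwa [Nat.cast_sub h.1] at this
      · exact isWeightedHomogeneous_zero _ _ _

/-- An irreducible polynomial over a unique factorization domain has nonzero resultant with every
polynomial it does not divide. -/
lemma resultant_ne_zero_of_irreducible_of_not_dvd {R : Type*} [CommRing R] [IsDomain R]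
    [UniqueFactorizationMonoid R] {F G : Polynomial R} (hF : Irreducible F) (hFG : ¬ F ∣ G) :
    F.resultant G ≠ 0 := by
  classical
  rcases Nat.eq_zero_or_pos F.natDegree with h0 | hpos
  · rw [h0, Polynomial.resultant_zero_left_deg]
    refine pow_ne_zero _ fun hc => hF.ne_zero ?_
    rw [Polynomial.eq_C_of_natDegree_eq_zero h0, hc, Polynomial.C_0]
  · let _ : StrongNormalizationMonoid R := UniqueFactorizationMonoid.strongNormalizationMonoid
    let _ : NormalizedGCDMonoid R := UniqueFactorizationMonoid.toNormalizedGCDMonoid R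
    have hprim : F.IsPrimitive := hF.isPrimitive hpos.ne'
    let L := FractionRing R
    have hinj : Function.Injective (algebraMap R L) := IsFractionRing.injective R L
    have hirr : Irreducible (F.map (algebraMap R L)) :=
      hprim.irreducible_iff_irreducible_map_fraction_map.1 hF
    have hnd : ¬ F.map (algebraMap R L) ∣ G.map (algebraMap R L) := by
      rintro ⟨k, hk⟩
      have hlift : F.map (algebraMap R L) * k ∈ Polynomial.lifts (algebraMap R L) := by
        rw [← hk, Polynomial.mem_lifts]
        exact ⟨G, rfl⟩
      rw [hprim.map_mul_mem_lifts_iff, Polynomial.mem_lifts] at hlift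
      obtain ⟨k', rfl⟩ := hlift
      rw [← Polynomial.map_mul] at hk
      exact hFG ⟨k', Polynomial.map_injective _ hinj hk⟩
    have hcop := hirr.coprime_iff_not_dvd.2 hnd
    intro hz
    have hz' : (F.map (algebraMap R L)).resultant (G.map (algebraMap R L)) = 0 := by
      rw [Polynomial.natDegree_map_eq_of_injective hinj,
        Polynomial.natDegree_map_eq_of_injective hinj, Polynomial.resultant_map_map, hz, map_zero]
    exact (Polynomial.resultant_eq_zero_iff.1 hz').2 hcop

/-- Bézout's inequality at the point `(1, 1, 1)` for weighted homogeneous polynomials, assuming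
`a ≤ b * c`. -/
lemma mul_le_mul_of_not_dvd {K : Type*} [Field K] {a b c : ℕ}
    (hb : 0 < b) (hc : 0 < c) (hbc : Nat.Coprime b c) (habc : a ≤ b * c)
    {f g : MvPolynomial (Fin 3) K} {d e r s : ℕ} (hf : Irreducible f) (hfg : ¬ f ∣ g)
    (hfd : f.IsWeightedHomogeneous (wt a b c) d) (hge : g.IsWeightedHomogeneous (wt a b c) e)
    (hfr : f ∈ onePointIdeal (Fin 3) K ^ r) (hgs : g ∈ onePointIdeal (Fin 3) K ^ s) :
    a * b * c * (r * s) ≤ d * e := by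
  set F := finSuccEquiv K 2 f with hF
  set G := finSuccEquiv K 2 g with hG
  have hg0 : g ≠ 0 := by rintro rfl; exact hfg (dvd_zero _)
  have hFirr : Irreducible F := (MulEquiv.irreducible_iff (finSuccEquiv K 2)).2 hf
  have hFG : ¬ F ∣ G := fun h => hfg ((map_dvd_iff (finSuccEquiv K 2)).1 h)
  have hG0 : G ≠ 0 := by simpa [hG] using hg0
  set m := F.natDegree with hm
  set n := G.natDegree with hn
  have hFc := isWeightedHomogeneous_finSuccEquiv_coeff hfd
  have hGc := isWeightedHomogeneous_finSuccEquiv_coeff hge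
  have hFt := taylor_finSuccEquiv_coeff_mem r f hfr
  have hGt := taylor_finSuccEquiv_coeff_mem s g hgs
  have hres := mul_le_of_mem_onePointIdeal_pow hb hc hbc
    (resultant_ne_zero_of_irreducible_of_not_dvd hFirr hFG)
    (resultant_isWeightedHomogeneous (m := m) (n := n) hFc hGc)
    (N := n * (r - min r m) + m * (s - min s n) + min r m * min s n) (by
      rw [← Polynomial.resultant_taylor F G 1, Polynomial.natDegree_taylor,
        Polynomial.natDegree_taylor]
      exact resultant_mem_pow _ hFt hGt)
  have hlead : ∀ P : Polynomial (MvPolynomial (Fin 2) K),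
      (P.taylor 1).coeff P.natDegree = P.coeff P.natDegree := fun P => by simp
  have h1 := mul_le_of_mem_onePointIdeal_pow hb hc hbc
    (Polynomial.leadingCoeff_ne_zero.2 hFirr.ne_zero) (hFc m) (N := r - m) (by
      rw [Polynomial.leadingCoeff, ← hlead]; exact hFt m)
  have h2 := mul_le_of_mem_onePointIdeal_pow hb hc hbc
    (Polynomial.leadingCoeff_ne_zero.2 hG0) (hGc n) (N := s - n) (by
      rw [Polynomial.leadingCoeff, ← hlead]; exact hGt n)
  have hN : r * s ≤ (r - m) * (s - n) +
      (n * (r - min r m) + m * (s - min s n) + min r m * min s n) := by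
    rcases le_total r m with hrm | hrm <;> rcases le_total s n with hsn | hsn <;>
      simp only [min_eq_left, min_eq_right, hrm, hsn, Nat.sub_self]
    · simp
    · obtain ⟨k, rfl⟩ := Nat.exists_eq_add_of_le hsn
      simp only [Nat.add_sub_cancel_left]
      nlinarith [Nat.mul_le_mul_right k hrm]
    · obtain ⟨k, rfl⟩ := Nat.exists_eq_add_of_le hrm
      simp only [Nat.add_sub_cancel_left]
      nlinarith [Nat.mul_le_mul_right k hsn]
    · obtain ⟨k, rfl⟩ := Nat.exists_eq_add_of_le hrm
      obtain ⟨l, rfl⟩ := Nat.exists_eq_add_of_le hsn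
      simp only [Nat.add_sub_cancel_left]
      nlinarith
  set N := n * (r - min r m) + m * (s - min s n) + min r m * min s n
  have h3 : (b * c * (r - m : ℕ) : ℤ) * (b * c * (s - n : ℕ)) ≤ (d - a * m) * (e - a * n) :=
    mul_le_mul h1 h2 (by positivity) (le_trans (by positivity) h1)
  have h4 : (a : ℤ) * (b * c * N) ≤ a * (n * d + m * e - a * m * n) :=
    mul_le_mul_of_nonneg_left hres (by positivity)
  have h5 : (a : ℤ) * (b * c * ((r - m : ℕ) * (s - n : ℕ))) ≤
      (b * c) * (b * c * ((r - m : ℕ) * (s - n : ℕ))) :=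
    mul_le_mul_of_nonneg_right (by exact_mod_cast habc) (by positivity)
  have h6 : (a * b * c : ℤ) * (r * s) ≤ (a * b * c) * ((r - m : ℕ) * (s - n : ℕ) + N) :=
    mul_le_mul_of_nonneg_left (by exact_mod_cast hN) (by positivity)
  have : (a * b * c * (r * s) : ℤ) ≤ d * e := by linarith
  exact_mod_cast this

/-- Uniqueness of a negative curve, up to divisibility. -/
lemma dvd_of_isWeightedHomogeneous_of_mem_pow {K : Type*} [Field K] {a b c : ℕ}
    (ha : 0 < a) (hb : 0 < b) (hc : 0 < c) (hbc : Nat.Coprime b c) (hca : Nat.Coprime c a)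
    {f g : MvPolynomial (Fin 3) K} {d r : ℕ} (hf : Irreducible f)
    (hfd : f.IsWeightedHomogeneous (wt a b c) d) (hgd : g.IsWeightedHomogeneous (wt a b c) d)
    (hfr : f ∈ onePointIdeal (Fin 3) K ^ r) (hgr : g ∈ onePointIdeal (Fin 3) K ^ r)
    (hneg : d ^ 2 < a * b * c * r ^ 2) : f ∣ g := by
  by_contra hfg
  rcases le_total a (b * c) with h | h
  · have := mul_le_mul_of_not_dvd hb hc hbc h hf hfg hfd hgd hfr hgr
    nlinarith
  · have h' : b ≤ a * c := by nlinarith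
    set τ := Equiv.swap (0 : Fin 3) 1
    set ρ := renameEquiv K τ with hρ
    have hhom : ∀ p : MvPolynomial (Fin 3) K, p.IsWeightedHomogeneous (wt a b c) d →
        (ρ p).IsWeightedHomogeneous (wt b a c) d := by
      intro p hp e he
      obtain ⟨u, rfl, hu⟩ := coeff_rename_ne_zero _ _ _ he
      have := hp hu
      rw [← this]
      simp only [Finsupp.weight_apply]
      rw [Finsupp.sum_mapDomain_index (by simp) (by simp [add_mul])]
      refine Finsupp.sum_congr fun i _ => ?_
      congr 1
      fin_cases i <;> simp [τ, wt]
      rfl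
    have hmem : ∀ p ∈ onePointIdeal (Fin 3) K ^ r, ρ p ∈ onePointIdeal (Fin 3) K ^ r := by
      intro p hp
      have hle : (onePointIdeal (Fin 3) K).map ρ ≤ onePointIdeal (Fin 3) K := by
        rw [Ideal.map_le_iff_le_comap]
        intro q hq
        have hq' : MvPolynomial.eval (fun _ => (1 : K)) q = 0 := hq
        change MvPolynomial.eval (fun _ => (1 : K)) (rename τ q) = 0
        rw [eval_rename]
        exact hq'
      have := Ideal.mem_map_of_mem ρ hp
      rw [Ideal.map_pow] at this
      exact Ideal.pow_right_mono hle r this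
    have := mul_le_mul_of_not_dvd ha hc hca.symm h' ((MulEquiv.irreducible_iff ρ).2 hf)
      (fun h => hfg ((map_dvd_iff ρ).1 h)) (hhom f hfd) (hhom g hgd) (hmem f hfr) (hmem g hgr)
    nlinarith

/-- A polynomial of the same weighted degree as a negative curve and with at least the same
multiplicity is a scalar multiple of it. -/
lemma exists_eq_C_mul_of_mem_pow {K : Type*} [Field K] {a b c : ℕ}
    (ha : 0 < a) (hb : 0 < b) (hc : 0 < c) (hbc : Nat.Coprime b c) (hca : Nat.Coprime c a)
    {f g : MvPolynomial (Fin 3) K} {d r : ℕ} (hf : Irreducible f)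
    (hfd : f.IsWeightedHomogeneous (wt a b c) d) (hgd : g.IsWeightedHomogeneous (wt a b c) d)
    (hfr : f ∈ onePointIdeal (Fin 3) K ^ r) (hgr : g ∈ onePointIdeal (Fin 3) K ^ r)
    (hneg : d ^ 2 < a * b * c * r ^ 2) : ∃ t : K, g = C t * f := by
  obtain ⟨u, rfl⟩ := dvd_of_isWeightedHomogeneous_of_mem_pow ha hb hc hbc hca hf hfd hgd hfr hgr hneg
  refine ⟨u.coeff 0, ?_⟩
  let _ : GradedAlgebra (weightedHomogeneousSubmodule K (wt a b c)) :=
    weightedGradedAlgebra K (wt a b c)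
  have h := DirectSum.coe_decompose_mul_add_of_left_mem
    (weightedHomogeneousSubmodule K (wt a b c)) (i := d) (j := 0) (a := f) (b := u) hfd
  rw [add_zero, DirectSum.decompose_of_mem_same _ hgd] at h
  have h0 : ((DirectSum.decompose (weightedHomogeneousSubmodule K (wt a b c)) u 0 :
      weightedHomogeneousSubmodule K (wt a b c) 0) : MvPolynomial (Fin 3) K) = C (u.coeff 0) := by
    rw [← weightedHomogeneousComponent_zero (w := wt a b c) u
      (by intro i; fin_cases i <;> simp [wt] <;> omega)]
    exact weightedDecomposition.decompose'_apply K (wt a b c) u 0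
  rw [h, h0, mul_comm]

instance onePointIdeal_isMaximal (σ K : Type*) [Field K] : (onePointIdeal σ K).IsMaximal :=
  RingHom.ker_isMaximal_of_surjective _ fun r => ⟨C r, by simp⟩

lemma eval_one_toPoly {K : Type*} [CommRing K] (a b c : ℕ) (f : MvPolynomial (Fin 3) K) :
    (toPoly K a b c f).eval 1 = MvPolynomial.eval (fun _ => (1 : K)) f := by
  have hcomp : (Polynomial.evalRingHom (1 : K)).comp
      (toPoly K a b c : MvPolynomial (Fin 3) K →+* Polynomial K) =
      MvPolynomial.eval (fun _ => (1 : K)) := by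
    apply MvPolynomial.ringHom_ext
    · intro r; simp [toPoly]
    · intro i
      fin_cases i <;> simp [toPoly]
  exact RingHom.congr_fun hcomp f

lemma toPoly_of_isWeightedHomogeneous {K : Type*} [CommRing K] {a b c d : ℕ}
    {f : MvPolynomial (Fin 3) K} (hf : f.IsWeightedHomogeneous (wt a b c) d) :
    toPoly K a b c f =
      Polynomial.C (MvPolynomial.eval (fun _ => (1 : K)) f) * Polynomial.X ^ d := by
  have hmon : toPoly K a b c f = ∑ e ∈ f.support, Polynomial.C (f.coeff e) * Polynomial.X ^ d := by
    conv_lhs => rw [f.as_sum]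
    rw [map_sum]
    refine Finset.sum_congr rfl fun e he => ?_
    have := hf (mem_support_iff.1 he)
    rw [toPoly, aeval_monomial, ← this, Finsupp.prod_fintype _ _ (by simp), Finsupp.weight_apply,
      Finsupp.sum_fintype _ _ (by simp)]
    simp [Fin.prod_univ_three, Fin.sum_univ_three, wt, ← pow_mul, ← pow_add, mul_comm]
  rw [hmon, ← Finset.sum_mul, ← map_sum]
  congr 2
  rw [MvPolynomial.eval_eq]
  simp

lemma mem_pIdeal_iff_of_isWeightedHomogeneous {K : Type*} [Field K] {a b c d : ℕ}
    {f : MvPolynomial (Fin 3) K} (hf : f.IsWeightedHomogeneous (wt a b c) d) :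
    f ∈ pIdeal K a b c ↔ f ∈ onePointIdeal (Fin 3) K := by
  rw [pIdeal, RingHom.mem_ker, toPoly_of_isWeightedHomogeneous hf, onePointIdeal, RingHom.mem_ker]
  simp

lemma pIdeal_le_onePointIdeal (K : Type*) [Field K] (a b c : ℕ) :
    pIdeal K a b c ≤ onePointIdeal (Fin 3) K := by
  intro f hf
  have h : toPoly K a b c f = 0 := hf
  rw [onePointIdeal, RingHom.mem_ker, ← eval_one_toPoly a b c, h, Polynomial.eval_zero]

lemma coeff_toPoly {K : Type*} [Field K] (a b c : ℕ) (f : MvPolynomial (Fin 3) K) (k : ℕ) :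
    (toPoly K a b c f).coeff k =
      MvPolynomial.eval (fun _ => (1 : K)) (weightedHomogeneousComponent (wt a b c) k f) := by
  induction f using MvPolynomial.induction_on' with
  | monomial e r =>
    have h := isWeightedHomogeneous_monomial (wt a b c) e r rfl
    rw [toPoly_of_isWeightedHomogeneous h, Polynomial.coeff_C_mul_X_pow,
      weightedHomogeneousComponent_of_mem h]
    split_ifs <;> simp
  | add p q hp hq => simp [hp, hq]

lemma pIdeal_isHomogeneous (K : Type*) [Field K] (a b c : ℕ) :
    letI := weightedGradedAlgebra K (wt a b c)
    (pIdeal K a b c).IsHomogeneous (weightedHomogeneousSubmodule K (wt a b c)) := by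
  intro k q hq
  have h := coeff_toPoly a b c q k
  rw [show toPoly K a b c q = 0 from hq, Polynomial.coeff_zero] at h
  have hk : weightedHomogeneousComponent (wt a b c) k q ∈ pIdeal K a b c :=
    (mem_pIdeal_iff_of_isWeightedHomogeneous
      (weightedHomogeneousComponent_isWeightedHomogeneous k q)).2 h.symm
  rwa [← weightedDecomposition.decompose'_apply K (wt a b c)] at hk

/-- A weighted homogeneous element of the `n`-th symbolic power of `𝔭` vanishes to order `n` at the
point `(1, 1, 1)` of the monomial curve. -/
lemma mem_onePointIdeal_pow_of_mem_symbPow {K : Type*} [Field K] {a b c d n : ℕ}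
    {f : MvPolynomial (Fin 3) K} (hfd : f.IsWeightedHomogeneous (wt a b c) d)
    (hf : f ∈ symbPow (pIdeal K a b c) n) : f ∈ onePointIdeal (Fin 3) K ^ n := by
  let _ : GradedAlgebra (weightedHomogeneousSubmodule K (wt a b c)) :=
    weightedGradedAlgebra K (wt a b c)
  rw [symbPow, Ideal.mem_comap,
    IsLocalization.algebraMap_mem_map_algebraMap_iff (pIdeal K a b c).primeCompl] at hf
  obtain ⟨s, hs, hsf⟩ := hf
  have hpow : (pIdeal K a b c ^ n).IsHomogeneous
      (weightedHomogeneousSubmodule K (wt a b c)) := by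
    induction n with
    | zero => rw [pow_zero, Ideal.one_eq_top]; exact Ideal.IsHomogeneous.top _
    | succ n ih =>
      rw [pow_succ]
      exact (ih (Ideal.pow_le_pow_right n.le_succ hsf)).mul (pIdeal_isHomogeneous K a b c)
  obtain ⟨k, hk⟩ : ∃ k, weightedHomogeneousComponent (wt a b c) k s ∉ pIdeal K a b c := by
    by_contra hall
    push Not at hall
    exact hs ((mem_iff_weightedHomogeneousComponent_mem K (wt a b c)
      (pIdeal_isHomogeneous K a b c) s).2 hall)
  have hmem := hpow (k + d) hsf
  rw [DirectSum.coe_decompose_mul_add_of_right_mem _ hfd] at hmem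
  have hcomp : ((DirectSum.decompose (weightedHomogeneousSubmodule K (wt a b c)) s k :
      weightedHomogeneousSubmodule K (wt a b c) k) : MvPolynomial (Fin 3) K) =
      weightedHomogeneousComponent (wt a b c) k s :=
    weightedDecomposition.decompose'_apply K (wt a b c) s k
  rw [hcomp] at hmem
  refine (Ideal.IsMaximal.mul_mem_pow _
    (Ideal.pow_right_mono (pIdeal_le_onePointIdeal K a b c) n hmem)).resolve_left ?_
  rwa [← mem_pIdeal_iff_of_isWeightedHomogeneous
    (weightedHomogeneousComponent_isWeightedHomogeneous k s)]

/-- Differentiation lowers the order of vanishing by at most one. -/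
lemma derivation_mem_pow {K A : Type*} [CommRing K] [CommRing A] [Algebra K A]
    (D : Derivation K A A) (I : Ideal A) (n : ℕ) : ∀ f ∈ I ^ (n + 1), D f ∈ I ^ n := by
  induction n with
  | zero => intro f _; simp
  | succ n ih =>
    intro f hf
    rw [pow_succ] at hf
    refine Submodule.mul_induction_on hf ?_ ?_
    · intro u hu v hv
      rw [Derivation.leibniz, smul_eq_mul, smul_eq_mul]
      refine Ideal.add_mem _ (Ideal.mul_mem_right _ _ hu) ?_
      rw [pow_succ, mul_comm v]
      exact Ideal.mul_mem_mul (ih u hu) hv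
    · intro u v hu hv
      rw [map_add]
      exact Ideal.add_mem _ hu hv

lemma coeff_X_mul_pderiv {σ K : Type*} [CommRing K] (i : σ) (f : MvPolynomial σ K) (e : σ →₀ ℕ) :
    (X i * pderiv i f).coeff e = e i * f.coeff e := by
  classical
  induction f using MvPolynomial.induction_on' with
  | monomial u r =>
    rw [X_mul_pderiv_monomial, coeff_smul, coeff_monomial]
    split_ifs with h
    · subst h; simp
    · simp
  | add p q hp hq => rw [map_add, mul_add, coeff_add, hp, hq, coeff_add, mul_add]

/-- An irreducible polynomial vanishing at the point `(1, …, 1)` is not divisible by a variable. -/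
lemma exists_mem_support_eq_zero {K : Type*} [Field K] {σ : Type*} {f : MvPolynomial σ K}
    (hf : Irreducible f) (h1 : f ∈ onePointIdeal σ K) (i : σ) :
    ∃ e ∈ f.support, e i = 0 := by
  by_contra! hall
  have hX : X i ∣ f := by
    rw [X_dvd_iff_modMonomial_eq_zero]
    ext e
    by_cases he : Finsupp.single i 1 ≤ e
    · rw [coeff_modMonomial_of_le _ he, coeff_zero]
    · rw [coeff_modMonomial_of_not_le _ he, coeff_zero]
      by_contra hne
      exact he (by simpa [Nat.one_le_iff_ne_zero] using hall e (mem_support_iff.2 hne))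
  obtain ⟨u, hu⟩ := hX
  rcases hf.isUnit_or_isUnit hu with h | h
  · have := h.map (MvPolynomial.eval (fun _ => (0 : K)))
    simp at this
  · have heval : MvPolynomial.eval (fun _ => (1 : K)) f = 0 := h1
    rw [hu] at heval
    have := h.map (MvPolynomial.eval (fun _ => (1 : K)))
    simp at heval
    simp [heval] at this

/-- A polynomial in characteristic `p` all of whose exponents are divisible by `p` and all of whose
coefficients are fixed by Frobenius is a `p`-th power. -/
lemma exists_pow_eq_of_dvd_of_frobenius {K σ : Type*} [Field K] (p : ℕ) [Fact p.Prime] [CharP K p]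
    {f : MvPolynomial σ K} (hdvd : ∀ e ∈ f.support, ∀ i, p ∣ e i)
    (hfrob : ∀ e, f.coeff e ^ p = f.coeff e) : ∃ h, f = h ^ p := by
  let u : (σ →₀ ℕ) → (σ →₀ ℕ) := fun e => e.mapRange (· / p) (by simp)
  have hu : ∀ e ∈ f.support, e = p • u e := fun e he => by
    ext i
    simp [u, Nat.mul_div_cancel' (hdvd e he i)]
  refine ⟨∑ e ∈ f.support, monomial (u e) (f.coeff e), ?_⟩
  rw [sum_pow_char]
  conv_lhs => rw [f.as_sum]
  refine Finset.sum_congr rfl fun e he => ?_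
  rw [monomial_pow, hfrob, ← hu e he]

/-- Raising the coefficients to the `p`-th power preserves the order of vanishing at `(1, …, 1)`. -/
lemma map_frobenius_mem_onePointIdeal_pow {K σ : Type*} [Field K] (p : ℕ) [ExpChar K p]
    {f : MvPolynomial σ K} {n : ℕ} (hf : f ∈ onePointIdeal σ K ^ n) :
    MvPolynomial.map (frobenius K p) f ∈ onePointIdeal σ K ^ n := by
  have hle : (onePointIdeal σ K).map (MvPolynomial.map (frobenius K p)) ≤ onePointIdeal σ K := by
    rw [Ideal.map_le_iff_le_comap]
    intro q hq
    have hq' : MvPolynomial.eval (fun _ => (1 : K)) q = 0 := hq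
    have hcomp : (MvPolynomial.eval (fun _ => (1 : K))).comp
        (MvPolynomial.map (σ := σ) (frobenius K p)) =
        (frobenius K p).comp (MvPolynomial.eval (fun _ => (1 : K))) := by
      apply MvPolynomial.ringHom_ext
      · intro r; simp
      · intro i; simp
    have := RingHom.congr_fun hcomp q
    rw [RingHom.comp_apply, RingHom.comp_apply, hq', map_zero] at this
    exact this
  have := Ideal.mem_map_of_mem (MvPolynomial.map (frobenius K p)) hf
  rw [Ideal.map_pow] at this
  exact Ideal.pow_right_mono hle n this

/-- a negative curve `f ∈ [𝔭^{(r0)}]_{d0}` satisfies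
`f ∉ 𝔭^{(r0+1)}`; in particular `r0` is uniquely determined by `f`. -/
theorem statement8 (K : Type*) [Field K] (a b c : ℕ)
    (ha : 0 < a) (hb : 0 < b) (hc : 0 < c)
    (hab : Nat.Coprime a b) (hbc : Nat.Coprime b c) (hca : Nat.Coprime c a)
    (f : MvPolynomial (Fin 3) K) (r0 d0 : ℕ) (hr0 : 0 < r0) (hd0 : 0 < d0)
    (hirr : Irreducible f)
    (hf : f ∈ symbPow (pIdeal K a b c) r0)
    (hfh : f.IsWeightedHomogeneous (wt a b c) d0)
    (hneg : d0 ^ 2 < a * b * c * r0 ^ 2) :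
    f ∉ symbPow (pIdeal K a b c) (r0 + 1) := by
  intro hf'
  have hmul := mem_onePointIdeal_pow_of_mem_symbPow hfh hf
  have hmul' := mem_onePointIdeal_pow_of_mem_symbPow hfh hf'
  have hone : f ∈ onePointIdeal (Fin 3) K := by
    simpa using Ideal.pow_le_pow_right hr0 hmul
  have hexp : ∀ e ∈ f.support, ∀ i, (e i : K) = 0 := by
    intro e he i
    obtain ⟨t, ht⟩ := exists_eq_C_mul_of_mem_pow ha hb hc hbc hca hirr hfh
      (g := X i * pderiv i f) (by
        intro u hu
        rw [coeff_X_mul_pderiv] at hu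
        exact hfh (right_ne_zero_of_mul hu)) hmul
      (Ideal.mul_mem_left _ _ (derivation_mem_pow _ _ _ f hmul')) hneg
    have hcoeff : ∀ u ∈ f.support, (u i : K) = t := by
      intro u hu
      have := congrArg (coeff u) ht
      rw [coeff_X_mul_pderiv, coeff_C_mul] at this
      exact mul_right_cancel₀ (mem_support_iff.1 hu) this
    obtain ⟨u, hu, hui⟩ := exists_mem_support_eq_zero hirr hone i
    rw [hcoeff e he, ← hcoeff u hu, hui, Nat.cast_zero]
  obtain ⟨p, hp⟩ := CharP.exists K
  have hdvd : ∀ e ∈ f.support, ∀ i, p ∣ e i := fun e he i =>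
    (CharP.cast_eq_zero_iff K p _).1 (hexp e he i)
  obtain ⟨e₀, he₀⟩ := support_nonempty.2 hirr.ne_zero
  rcases CharP.char_is_prime_or_zero K p with hprime | rfl
  · have : Fact p.Prime := ⟨hprime⟩
    have hα := mem_support_iff.1 he₀
    set α := f.coeff e₀ with hαdef
    have hunit : IsUnit (C α⁻¹ : MvPolynomial (Fin 3) K) :=
      (isUnit_iff_ne_zero.2 (inv_ne_zero hα)).map C
    obtain ⟨g, hg⟩ : ∃ g, g = C α⁻¹ * f := ⟨_, rfl⟩
    have hgirr : Irreducible g := hg ▸ (irreducible_isUnit_mul hunit).2 hirr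
    have hgh : g.IsWeightedHomogeneous (wt a b c) d0 := hg ▸ hfh.C_mul _
    have hgmul : g ∈ onePointIdeal (Fin 3) K ^ r0 := hg ▸ Ideal.mul_mem_left _ _ hmul
    have hg₀ : g.coeff e₀ = 1 := by rw [hg, coeff_C_mul, inv_mul_cancel₀ hα]
    obtain ⟨t, ht⟩ := exists_eq_C_mul_of_mem_pow ha hb hc hbc hca hgirr hgh
      (g := MvPolynomial.map (frobenius K p) g) (by
        intro u hu
        refine hgh fun h0 => hu ?_
        rw [coeff_map, h0, map_zero]) hgmul (map_frobenius_mem_onePointIdeal_pow p hgmul) hneg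
    have hcoeff : ∀ u, g.coeff u ^ p = t * g.coeff u := by
      intro u
      have := congrArg (coeff u) ht
      rwa [coeff_map, coeff_C_mul, frobenius_def] at this
    have ht1 : t = 1 := by simpa [hg₀] using (hcoeff e₀).symm
    obtain ⟨h, hh⟩ := exists_pow_eq_of_dvd_of_frobenius p (f := g)
      (fun e he => hdvd e (by
        rw [mem_support_iff, hg, coeff_C_mul] at he
        exact mem_support_iff.2 (right_ne_zero_of_mul he)))
      (fun u => by rw [hcoeff u, ht1, one_mul])
    rw [hh] at hgirr
    exact not_irreducible_pow hprime.ne_one hgirr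
  · have he : ∀ e ∈ f.support, e = 0 := fun e he => by
      ext i; simpa using hdvd e he i
    have := hfh (mem_support_iff.1 he₀)
    rw [he e₀ he₀, map_zero] at this
    omega
end

section
/- Let K be a field and a, b, c pairwise coprime positive integers. Suppose g1 ∈ [𝔭_K(a,b,c)^{(r1)}]_{d1} and g2 ∈ [𝔭_K(a,b,c)^{(r2)}]_{d2} form an S-regular sequence with (d1/r1)·(d2/r2) = abc and d1/r1 ≤ √(abc) ≤ d2/r2, and suppose there exists a negative curve f ∈ [𝔭_K(a,b,c)^{(r0)}]_{d0} with d0/r0 < √(abc). Then d0/r0 = d1/r1, and g1 = c·f^n for some positive integer n and some c ∈ K^×. -/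
open MvPolynomial

/-- A polynomial, read as a power series, has order at least `n` iff it lies in the `n`-th power
of the ideal of the variables. -/
theorem natCast_le_order_iff {σ R : Type*} [CommRing R] (F : MvPolynomial σ R) (n : ℕ) :
    (n : ℕ∞) ≤ (F : MvPowerSeries σ R).order ↔ F ∈ idealOfVars σ R ^ n := by
  rw [mem_pow_idealOfVars_iff']
  constructor
  · intro h x hx
    rw [← coeff_coe]
    exact MvPowerSeries.coeff_of_lt_order (lt_of_lt_of_le (by exact_mod_cast hx) h)
  · intro h
    refine MvPowerSeries.nat_le_order fun d hd => ?_
    rw [coeff_coe]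
    exact h d hd

/-- The dehomogenization of `K[x,y,z]` in the coordinates `1 + U`, `1 + V` of a two-dimensional
torus. -/
noncomputable def chart (K : Type*) [CommRing K] (p q : ℕ) :
    MvPolynomial (Fin 3) K →ₐ[K] MvPolynomial (Fin 2) K :=
  aeval ![(1 + X 0) ^ p, (1 + X 0) ^ q, 1 + X 1]

theorem chart_monomial (K : Type*) [CommRing K] (p q : ℕ) (m : Fin 3 →₀ ℕ) (r : K) :
    chart K p q (monomial m r) =
      C r * ((1 + X 0) ^ (p * m 0 + q * m 1) * (1 + X 1) ^ m 2) := by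
  rw [chart, aeval_monomial]
  simp [Finsupp.prod_fintype, Fin.prod_univ_three, pow_add, pow_mul, algebraMap_eq]

/-- The order of vanishing at the point `(1,1,1)`, computed in the chart. -/
noncomputable def pointOrder (K : Type*) [Field K] (p q : ℕ) (f : MvPolynomial (Fin 3) K) : ℕ∞ :=
  (chart K p q f : MvPowerSeries (Fin 2) K).order

section pointOrder

variable {K : Type*} [Field K] {p q : ℕ}

theorem natCast_le_pointOrder_iff {f : MvPolynomial (Fin 3) K} {n : ℕ} :
    (n : ℕ∞) ≤ pointOrder K p q f ↔ chart K p q f ∈ idealOfVars (Fin 2) K ^ n :=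
  natCast_le_order_iff _ _

theorem pointOrder_mul (f g : MvPolynomial (Fin 3) K) :
    pointOrder K p q (f * g) = pointOrder K p q f + pointOrder K p q g := by
  simp only [pointOrder, map_mul, coe_mul, MvPowerSeries.order_mul]

theorem pointOrder_pow (f : MvPolynomial (Fin 3) K) (n : ℕ) :
    pointOrder K p q (f ^ n) = n * pointOrder K p q f := by
  induction n with
  | zero => simp [pointOrder, MvPowerSeries.order, MvPowerSeries.weightedOrder_one]
  | succ n ih => rw [pow_succ, pointOrder_mul, ih]; push_cast; ring

end pointOrder

theorem weight_wt (a b c : ℕ) (m : Fin 3 →₀ ℕ) :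
    Finsupp.weight (wt a b c) m = m 0 * a + m 1 * b + m 2 * c := by
  simp [Finsupp.weight_apply, Finsupp.sum_fintype, Fin.sum_univ_three, wt]

/-- The chart with the grading variable `T` kept. -/
noncomputable def gradedChart (K : Type*) [CommRing K] (a b c p q : ℕ) :
    MvPolynomial (Fin 3) K →ₐ[K] MvPolynomial (Fin 2) (Polynomial K) :=
  aeval ![C (Polynomial.X ^ a) * (1 + X 0) ^ p, C (Polynomial.X ^ b) * (1 + X 0) ^ q,
    C (Polynomial.X ^ c) * (1 + X 1)]

theorem gradedChart_eq_of_isWeightedHomogeneous {K : Type*} [CommRing K] {a b c p q d : ℕ}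
    {f : MvPolynomial (Fin 3) K} (hf : f.IsWeightedHomogeneous (wt a b c) d) :
    gradedChart K a b c p q f =
      C (Polynomial.X ^ d) * map Polynomial.C (chart K p q f) := by
  rw [f.as_sum, map_sum, map_sum, map_sum, Finset.mul_sum]
  refine Finset.sum_congr rfl fun m hm => ?_
  have hd := hf (mem_support_iff.mp hm)
  rw [weight_wt] at hd
  rw [chart_monomial, ← hd]
  simp only [gradedChart, aeval_monomial, Finsupp.prod_fintype, Fin.prod_univ_three, pow_add,
    pow_mul, map_mul, map_pow, map_add, map_one, map_X, map_C, mul_pow, pow_zero, implies_true,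
    MvPolynomial.algebraMap_apply, Polynomial.algebraMap_eq, Matrix.cons_val]
  rw [pow_right_comm (C Polynomial.X) a, pow_right_comm (C Polynomial.X) b,
    pow_right_comm (C Polynomial.X) c]
  ring

theorem constantCoeff_gradedChart (K : Type*) [CommRing K] (a b c p q : ℕ)
    (f : MvPolynomial (Fin 3) K) :
    constantCoeff (gradedChart K a b c p q f) = toPoly K a b c f := by
  induction f using MvPolynomial.induction_on with
  | C r => simp [MvPolynomial.algebraMap_apply]
  | add f g hf hg => simp [hf, hg]
  | mul_X f i hf =>
    rw [map_mul, map_mul, map_mul, hf]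
    congr 1
    fin_cases i <;> simp [gradedChart, toPoly]

theorem le_pointOrder_of_mem_symbPow {K : Type*} [Field K] {a b c p q d n : ℕ}
    {f : MvPolynomial (Fin 3) K} (hf : f ∈ symbPow (pIdeal K a b c) n)
    (hd : f.IsWeightedHomogeneous (wt a b c) d) : (n : ℕ∞) ≤ pointOrder K p q f := by
  rw [symbPow, Ideal.mem_comap,
    IsLocalization.algebraMap_mem_map_algebraMap_iff (pIdeal K a b c).primeCompl] at hf
  obtain ⟨s, hs, hsf⟩ := hf
  have hle : pIdeal K a b c ≤
      (idealOfVars (Fin 2) (Polynomial K)).comap (gradedChart K a b c p q) := by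
    intro g hg
    rw [Ideal.mem_comap, ← pow_one (idealOfVars (Fin 2) (Polynomial K)), mem_pow_idealOfVars_iff']
    intro x hx
    have hx0 : x = 0 := by
      rw [← Finsupp.degree_eq_zero_iff]; omega
    rw [hx0]
    have := constantCoeff_gradedChart K a b c p q g
    rw [constantCoeff_eq] at this
    rw [this]
    exact hg
  have hmem : gradedChart K a b c p q (s * f) ∈ idealOfVars (Fin 2) (Polynomial K) ^ n := by
    have := (Ideal.pow_right_mono hle n).trans (Ideal.le_comap_pow _ n) hsf
    exact this
  rw [← natCast_le_order_iff, map_mul, coe_mul, MvPowerSeries.order_mul] at hmem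
  have hs0 : (gradedChart K a b c p q s : MvPowerSeries (Fin 2) (Polynomial K)).order = 0 := by
    by_contra h
    rw [← ne_eq, MvPowerSeries.order_ne_zero_iff_constCoeff_eq_zero,
      ← MvPowerSeries.coeff_zero_eq_constantCoeff_apply, coeff_coe, ← constantCoeff_eq,
      constantCoeff_gradedChart] at h
    exact hs h
  rw [hs0, zero_add, natCast_le_order_iff, gradedChart_eq_of_isWeightedHomogeneous hd,
    mem_pow_idealOfVars_iff'] at hmem
  rw [natCast_le_pointOrder_iff, mem_pow_idealOfVars_iff']
  intro x hx
  have := hmem x hx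
  rw [coeff_C_mul, coeff_map] at this
  simpa using this

section HilbertFunction

/-- The exponents of weighted degree `n`. -/
def weightFiber (a b c n : ℕ) : Set (Fin 3 →₀ ℕ) := {m | Finsupp.weight (wt a b c) m = n}

variable {a b c : ℕ}

theorem wt_ne_zero (ha : 0 < a) (hb : 0 < b) (hc : 0 < c) (i : Fin 3) : wt a b c i ≠ 0 := by
  fin_cases i <;> simp [wt] <;> omega

theorem finite_weightFiber (ha : 0 < a) (hb : 0 < b) (hc : 0 < c) (n : ℕ) :
    (weightFiber a b c n).Finite :=
  Finsupp.finite_of_nat_weight_eq _ (wt_ne_zero ha hb hc) n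

theorem image_add_weightFiber (a b c n k : ℕ) (i : Fin 3) :
    (· + Finsupp.single i k) '' weightFiber a b c n =
      {m | m ∈ weightFiber a b c (n + k * wt a b c i) ∧ k ≤ m i} := by
  ext m
  constructor
  · rintro ⟨m, hm, rfl⟩
    simp only [weightFiber, Set.mem_ofPred] at hm ⊢
    simp [hm, Finsupp.weight_single]
  · rintro ⟨hm, hk⟩
    have hle : Finsupp.single i k ≤ m := by simpa using hk
    refine ⟨m - Finsupp.single i k, ?_, tsub_add_cancel_of_le hle⟩
    have h := congrArg (Finsupp.weight (wt a b c)) (tsub_add_cancel_of_le hle)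
    simp only [weightFiber, Set.mem_ofPred] at hm ⊢
    rw [map_add, hm, Finsupp.weight_single, smul_eq_mul] at h
    omega

theorem ncard_image_add_weightFiber (a b c n k : ℕ) (i : Fin 3) :
    ((· + Finsupp.single i k) '' weightFiber a b c n).ncard = (weightFiber a b c n).ncard :=
  Set.ncard_image_of_injective _ (add_left_injective _)

theorem ncard_weightFiber_box_le (hab : Nat.Coprime a b) (hb : 0 < b) (n d e : ℕ) :
    {m | m ∈ weightFiber a b c n ∧ m 0 < b * d ∧ m 2 < e}.ncard ≤ d * e := by
  have hcard : ((Finset.range d ×ˢ Finset.range e : Finset (ℕ × ℕ)) : Set (ℕ × ℕ)).ncard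
      = d * e := by
    rw [Set.ncard_coe_finset]; simp
  rw [← hcard]
  refine Set.ncard_le_ncard_of_injOn (fun m => (m 0 / b, m 2)) ?_ ?_ (Finset.finite_toSet _)
  · rintro m ⟨-, h0, h2⟩
    simpa using ⟨Nat.div_lt_of_lt_mul h0, h2⟩
  · rintro m ⟨hm, -, -⟩ m' ⟨hm', -, -⟩ h
    simp only [Prod.mk.injEq] at h
    obtain ⟨h0, h2⟩ := h
    simp only [weightFiber, Set.mem_ofPred, weight_wt] at hm hm'
    rw [h2] at hm
    have hmod : m 0 ≡ m' 0 [MOD b] := by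
      have h1 : a * m 0 + b * m 1 = a * m' 0 + b * m' 1 := by linarith
      have h3 : a * m 0 ≡ a * m' 0 [MOD b] := by
        have : (a * m 0 + b * m 1) % b = (a * m' 0 + b * m' 1) % b := by rw [h1]
        simpa [Nat.ModEq, Nat.add_mul_mod_self_left] using this
      exact Nat.ModEq.cancel_left_of_coprime (by rw [Nat.gcd_comm]; exact hab) h3
    have e0 : m 0 = m' 0 := by
      rw [← Nat.div_add_mod (m 0) b, ← Nat.div_add_mod (m' 0) b, h0, hmod]
    have e1 : m 1 = m' 1 := by
      rw [e0] at hm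
      exact Nat.eq_of_mul_eq_mul_right hb (by linarith)
    ext i
    fin_cases i
    exacts [e0, e1, h2]

theorem ncard_weightFiber_add_le (hab : Nat.Coprime a b) (ha : 0 < a) (hb : 0 < b) (hc : 0 < c)
    (l d e : ℕ) :
    (weightFiber a b c (l + a * b * d + c * e)).ncard + (weightFiber a b c l).ncard ≤
      (weightFiber a b c (l + c * e)).ncard + (weightFiber a b c (l + a * b * d)).ncard
        + d * e := by
  set n := l + a * b * d + c * e with hn
  have hA := image_add_weightFiber a b c (l + c * e) (b * d) 0
  have hB := image_add_weightFiber a b c (l + a * b * d) e 2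
  have hC : (· + Finsupp.single (2 : Fin 3) e) '' ((· + Finsupp.single (0 : Fin 3) (b * d)) ''
      weightFiber a b c l) = {m | m ∈ weightFiber a b c n ∧ b * d ≤ m 0} ∩
        {m | m ∈ weightFiber a b c n ∧ e ≤ m 2} := by
    have h1 : l + b * d * wt a b c 0 + e * wt a b c 2 = n := by simp [wt, hn]; ring
    rw [image_add_weightFiber]
    ext m
    have h2 := Set.ext_iff.mp (image_add_weightFiber a b c (l + b * d * wt a b c 0) e 2) m
    rw [h1] at h2
    simp only [Set.mem_inter_iff, Set.mem_ofPred] at h2 ⊢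
    constructor
    · rintro ⟨m, ⟨hm, hk⟩, rfl⟩
      have := h2.mp ⟨m, hm, rfl⟩
      refine ⟨⟨this.1, ?_⟩, this⟩
      simpa using hk
    · rintro ⟨⟨hm, hk⟩, hm'⟩
      obtain ⟨m, hm0, rfl⟩ := h2.mpr hm'
      exact ⟨m, ⟨hm0, by simpa using hk⟩, rfl⟩
  have h1 : l + c * e + b * d * wt a b c 0 = n := by simp [wt, hn]; ring
  have h2 : l + a * b * d + e * wt a b c 2 = n := by simp [wt, hn]; ring
  rw [h1] at hA
  rw [h2] at hB
  have cA := ncard_image_add_weightFiber a b c (l + c * e) (b * d) 0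
  have cB := ncard_image_add_weightFiber a b c (l + a * b * d) e 2
  have cC := congrArg Set.ncard hC
  rw [Set.ncard_image_of_injective _ (add_left_injective _), ncard_image_add_weightFiber] at cC
  rw [hA] at cA
  rw [hB] at cB
  have hfin := finite_weightFiber ha hb hc n
  have hunion := Set.ncard_union_add_ncard_inter
    {m | m ∈ weightFiber a b c n ∧ b * d ≤ m 0} {m | m ∈ weightFiber a b c n ∧ e ≤ m 2}
    (hfin.subset fun _ h => h.1) (hfin.subset fun _ h => h.1)
  have hbox := ncard_weightFiber_box_le (c := c) hab hb n d e
  have hcover : weightFiber a b c n ⊆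
      ({m | m ∈ weightFiber a b c n ∧ b * d ≤ m 0} ∪ {m | m ∈ weightFiber a b c n ∧ e ≤ m 2}) ∪
        {m | m ∈ weightFiber a b c n ∧ m 0 < b * d ∧ m 2 < e} := by
    intro m hm
    simp only [Set.mem_union, Set.mem_ofPred, hm, true_and]
    omega
  have h3 := Set.ncard_le_ncard hcover (hfin.subset (by
    rintro m ((h | h) | h) <;> exact h.1))
  have h4 := h3.trans (Set.ncard_union_le _ _)
  omega

theorem finrank_weightedHomogeneousSubmodule (K : Type*) [Field K] (n : ℕ) :
    Module.finrank K (weightedHomogeneousSubmodule K (wt a b c) n) =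
      (weightFiber a b c n).ncard := by
  rw [weightedHomogeneousSubmodule_eq_finsupp_supported]
  exact Module.finrank_eq_nat_card_basis
    (basisRestrictSupport K {d | Finsupp.weight (wt a b c) d = n})

theorem finiteDimensional_weightedHomogeneousSubmodule (K : Type*) [Field K] (ha : 0 < a)
    (hb : 0 < b) (hc : 0 < c) (n : ℕ) :
    FiniteDimensional K (weightedHomogeneousSubmodule K (wt a b c) n) :=
  Module.Finite.iff_fg.mpr (weightedHomogeneousSubmodule_fg K _ (wt_ne_zero ha hb hc) n)

end HilbertFunction

section Jet

/-- Indices for the monomials in two variables of total degree less than `N`. -/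
abbrev JetIndex (N : ℕ) : Type := Σ k : Fin N, Fin (k + 1)

theorem two_mul_card_jetIndex (N : ℕ) : 2 * Fintype.card (JetIndex N) = N * (N + 1) := by
  simp only [JetIndex, Fintype.card_sigma, Fintype.card_fin]
  rw [Fin.sum_univ_eq_sum_range (fun k => k + 1) N]
  induction N with
  | zero => simp
  | succ N ih => rw [Finset.sum_range_succ, mul_add, ih]; ring

/-- The exponent attached to a jet index. -/
noncomputable def jetExponent {N : ℕ} (x : JetIndex N) : Fin 2 →₀ ℕ :=
  Finsupp.single 0 (x.2 : ℕ) + Finsupp.single 1 ((x.1 : ℕ) - x.2)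

theorem degree_jetExponent {N : ℕ} (x : JetIndex N) : (jetExponent x).degree = x.1 := by
  have := x.2.is_lt
  simp only [jetExponent, map_add, Finsupp.degree_single]
  omega

theorem exists_jetExponent_eq {N : ℕ} {m : Fin 2 →₀ ℕ} (hm : m.degree < N) :
    ∃ x : JetIndex N, jetExponent x = m := by
  have hd : m.degree = m 0 + m 1 := by
    simp [Finsupp.degree_eq_sum, Fin.sum_univ_two]
  refine ⟨⟨⟨m.degree, hm⟩, ⟨m 0, by simp only [hd]; omega⟩⟩, ?_⟩
  ext i
  fin_cases i <;> simp [jetExponent, hd]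

theorem jetExponent_injective (N : ℕ) : Function.Injective (jetExponent (N := N)) := by
  rintro ⟨⟨k, hk⟩, ⟨j, hj⟩⟩ ⟨⟨k', hk'⟩, ⟨j', hj'⟩⟩ h
  have hd := congrArg Finsupp.degree h
  rw [degree_jetExponent, degree_jetExponent] at hd
  have h0 := DFunLike.congr_fun h 0
  simp [jetExponent] at hd h0
  subst hd h0
  rfl

variable (K : Type*) [Field K]

/-- The coefficients of total degree less than `N`. -/
noncomputable def jet (N : ℕ) : MvPolynomial (Fin 2) K →ₗ[K] (JetIndex N → K) :=
  LinearMap.pi fun x => lcoeff K (jetExponent x)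

variable {K}

theorem jet_apply {N : ℕ} (F : MvPolynomial (Fin 2) K) (x : JetIndex N) :
    jet K N F x = coeff (jetExponent x) F := rfl

theorem jet_eq_zero_iff {N : ℕ} {F : MvPolynomial (Fin 2) K} :
    jet K N F = 0 ↔ F ∈ idealOfVars (Fin 2) K ^ N := by
  rw [mem_pow_idealOfVars_iff']
  constructor
  · intro h m hm
    obtain ⟨x, rfl⟩ := exists_jetExponent_eq hm
    exact congrFun h x
  · intro h
    funext x
    exact h _ (by rw [degree_jetExponent]; exact x.1.is_lt)

theorem jet_surjective (N : ℕ) : Function.Surjective (jet K N) := by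
  classical
  intro w
  refine ⟨∑ x, monomial (jetExponent x) (w x), funext fun y => ?_⟩
  rw [jet_apply, coeff_sum]
  simp [coeff_monomial, (jetExponent_injective N).eq_iff]

theorem finrank_jet (N : ℕ) :
    2 * Module.finrank K (JetIndex N → K) = N * (N + 1) := by
  rw [Module.finrank_fintype_fun_eq_card, two_mul_card_jetIndex]

/-- Modulo the `N`-th power of the ideal of the variables, every polynomial is a combination of
the products `(1 + U) ^ s * (1 + V) ^ t` with `s + t < N`. -/
theorem span_one_add_pow_sup_eq_top (N : ℕ) :
    Submodule.span K {F | ∃ s t : ℕ, s + t < N ∧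
      F = ((1 + X 0) ^ s * (1 + X 1) ^ t : MvPolynomial (Fin 2) K)} ⊔
      (idealOfVars (Fin 2) K ^ N).restrictScalars K = ⊤ := by
  rw [eq_top_iff]
  intro F _
  induction F using MvPolynomial.induction_on' with
  | add F G hF hG => exact add_mem (hF trivial) (hG trivial)
  | monomial m r =>
    by_cases hm : N ≤ m.degree
    · refine Submodule.mem_sup_right ?_
      by_cases hr : r = 0
      · simp [hr]
      · exact (monomial_mem_pow_idealOfVars_iff N m hr).mpr hm
    · refine Submodule.mem_sup_left ?_
      have hd : m.degree = m 0 + m 1 := by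
        simp [Finsupp.degree_eq_sum, Fin.sum_univ_two]
      have key : monomial m r = C r * ((((1 + X 0) + (-1)) ^ m 0 * ((1 + X 1) + (-1)) ^ m 1) :
          MvPolynomial (Fin 2) K) := by
        rw [monomial_eq]
        simp [Finsupp.prod_fintype, Fin.prod_univ_two]
      rw [key, ← smul_eq_C_mul]
      refine Submodule.smul_mem _ _ ?_
      rw [add_pow, add_pow, Finset.sum_mul_sum]
      refine sum_mem fun s hs => sum_mem fun t ht => ?_
      rw [Finset.mem_range] at hs ht
      have : ((1 + X 0) ^ s * (-1) ^ (m 0 - s) * ((m 0).choose s : MvPolynomial (Fin 2) K) *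
          ((1 + X 1) ^ t * (-1) ^ (m 1 - t) * ((m 1).choose t : MvPolynomial (Fin 2) K))) =
          ((-1) ^ (m 0 - s) * ((m 0).choose s : K) * ((-1) ^ (m 1 - t) * ((m 1).choose t : K))) •
            ((1 + X 0) ^ s * (1 + X 1) ^ t : MvPolynomial (Fin 2) K) := by
        rw [smul_eq_C_mul]
        simp only [map_mul, map_pow, map_neg, map_one, map_natCast]
        ring
      rw [this]
      exact Submodule.smul_mem _ _ (Submodule.subset_span ⟨s, t, by omega, rfl⟩)

theorem exists_mul_one_add_pow_sub_one_mem (N s : ℕ) :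
    ∃ E : MvPolynomial (Fin 2) K, (1 + X 0) ^ s * E - 1 ∈ idealOfVars (Fin 2) K ^ N := by
  have hnil : IsNilpotent (Ideal.Quotient.mk (idealOfVars (Fin 2) K ^ N) (X 0)) := by
    refine ⟨N, ?_⟩
    rw [← map_pow, Ideal.Quotient.eq_zero_iff_mem]
    exact Ideal.pow_mem_pow (Ideal.subset_span (Set.mem_range_self 0)) N
  obtain ⟨u, hu⟩ := (hnil.isUnit_one_add).pow s
  obtain ⟨E, hE⟩ := Ideal.Quotient.mk_surjective (u⁻¹ : Units _).val
  refine ⟨E, ?_⟩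
  rw [← Ideal.Quotient.eq_zero_iff_mem, map_sub, map_mul, hE, map_pow, map_add, map_one, ← hu,
    Units.mul_inv, sub_self]

end Jet

section Bezout

variable {K : Type*} [Field K] {a b c p q : ℕ}

theorem exists_chart_eq_one_add_pow (hpq : a * q = b * p + 1) (hb : 0 < b) {N k s t : ℕ}
    (hk : N * (1 + q * c) ≤ k) (hst : s + t < N) :
    ∃ f ∈ weightedHomogeneousSubmodule K (wt a b c) (a * b * k),
      chart K p q f = (1 + X 0) ^ (p * b * k) * ((1 + X 0) ^ s * (1 + X 1) ^ t) := by
  have hle : q * c * t + b * s ≤ b * k := by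
    have h1 : q * c * t ≤ b * (N * (q * c)) := by
      calc q * c * t ≤ q * c * N := Nat.mul_le_mul_left _ (by omega)
        _ = 1 * (N * (q * c)) := by ring
        _ ≤ b * (N * (q * c)) := Nat.mul_le_mul_right _ hb
    have h2 : b * s ≤ b * N := Nat.mul_le_mul_left _ (by omega)
    have h3 := Nat.mul_le_mul_left b hk
    nlinarith
  obtain ⟨i, hi⟩ := Nat.exists_eq_add_of_le hle
  refine ⟨monomial (Finsupp.single 0 i + Finsupp.single 1 (a * s + p * c * t) +
    Finsupp.single 2 t) 1, ?_, ?_⟩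
  · refine isWeightedHomogeneous_monomial _ _ _ ?_
    rw [weight_wt]
    simp
    zify at hi hpq ⊢
    linear_combination (-(a : ℤ)) * hi - (c * t : ℤ) * hpq
  · rw [chart_monomial, C_1, one_mul, ← mul_assoc, ← pow_add]
    simp
    refine Or.inl ?_
    congr 1
    zify at hi hpq ⊢
    linear_combination (-(p : ℤ)) * hi + (s : ℤ) * hpq

theorem exists_jet_chart_eq (hpq : a * q = b * p + 1) (hb : 0 < b) {N k : ℕ}
    (hk : N * (1 + q * c) ≤ k) (w : JetIndex N → K) :
    ∃ f ∈ weightedHomogeneousSubmodule K (wt a b c) (a * b * k), jet K N (chart K p q f) = w := by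
  obtain ⟨F, rfl⟩ := jet_surjective N w
  obtain ⟨E, hE⟩ := exists_mul_one_add_pow_sub_one_mem (K := K) N (p * b * k)
  have hEF : E * F ∈ (⊤ : Submodule K (MvPolynomial (Fin 2) K)) := trivial
  rw [← span_one_add_pow_sup_eq_top N, Submodule.mem_sup] at hEF
  obtain ⟨L, hL, R, hR, hLR⟩ := hEF
  have hf : ∃ f ∈ weightedHomogeneousSubmodule K (wt a b c) (a * b * k),
      chart K p q f = (1 + X 0) ^ (p * b * k) * L := by
    have hle : Submodule.span K {F | ∃ s t : ℕ, s + t < N ∧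
        F = ((1 + X 0) ^ s * (1 + X 1) ^ t : MvPolynomial (Fin 2) K)} ≤
        ((weightedHomogeneousSubmodule K (wt a b c) (a * b * k)).map
          (chart K p q).toLinearMap).comap
            (LinearMap.mulLeft K ((1 + X 0) ^ (p * b * k))) := by
      rw [Submodule.span_le]
      rintro _ ⟨s, t, hst, rfl⟩
      exact exists_chart_eq_one_add_pow hpq hb hk hst
    exact hle hL
  obtain ⟨f, hfm, hf⟩ := hf
  refine ⟨f, hfm, ?_⟩
  rw [← sub_eq_zero, ← map_sub, jet_eq_zero_iff, hf]
  have : (1 + X 0) ^ (p * b * k) * L - F =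
      ((1 + X 0) ^ (p * b * k) * E - 1) * F - (1 + X 0) ^ (p * b * k) * R := by
    linear_combination (1 + X 0) ^ (p * b * k) * hLR
  rw [this]
  exact sub_mem (Ideal.mul_mem_right _ _ hE) (Ideal.mul_mem_left _ _ hR)

theorem exists_isWeightedHomogeneous_of_mul {σ : Type*} {w : σ → ℕ} {d n : ℕ}
    {f g : MvPolynomial σ K} (hf0 : f ≠ 0) (hg0 : g ≠ 0) (hf : f.IsWeightedHomogeneous w d)
    (hfg : (f * g).IsWeightedHomogeneous w n) :
    ∃ e, n = d + e ∧ g.IsWeightedHomogeneous w e := by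
  classical
  let := weightedGradedAlgebra K w
  have h := DirectSum.coe_decompose_mul_of_left_mem
    (weightedHomogeneousSubmodule K w) (b := g) n ((mem_weightedHomogeneousSubmodule K w d f).mpr hf)
  rw [DirectSum.decompose_of_mem_same _ ((mem_weightedHomogeneousSubmodule K w n _).mpr hfg)] at h
  split_ifs at h with hle
  · refine ⟨n - d, by omega, ?_⟩
    rw [mul_left_cancel₀ hf0 h]
    exact (DirectSum.decompose (weightedHomogeneousSubmodule K w) g (n - d)).2
  · exact absurd h (mul_ne_zero hf0 hg0)

/-- Multiplication by a homogeneous polynomial, between homogeneous components. -/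
noncomputable def mulHomogeneous {σ : Type*} {w : σ → ℕ} {d : ℕ} (f : MvPolynomial σ K)
    (hf : f.IsWeightedHomogeneous w d) (l n : ℕ) (hn : d + l = n) :
    weightedHomogeneousSubmodule K w l →ₗ[K] weightedHomogeneousSubmodule K w n :=
  (LinearMap.mulLeft K f).restrict fun _ hg => hn ▸ hf.mul hg

theorem coe_mulHomogeneous {σ : Type*} {w : σ → ℕ} {d : ℕ} (f : MvPolynomial σ K)
    (hf : f.IsWeightedHomogeneous w d) (l n : ℕ) (hn : d + l = n)
    (g : weightedHomogeneousSubmodule K w l) :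
    (mulHomogeneous f hf l n hn g : MvPolynomial σ K) = f * g := rfl

/-- If `u` vanishes on the kernel of `v`, then the rank of `u` is at most the dimension of the
target of `v`. -/
theorem finrank_range_le_of_ker_le_ker {V W : Type*} [AddCommGroup V] [Module K V]
    [AddCommGroup W] [Module K W] {J : Type*} [AddCommGroup J] [Module K J]
    [FiniteDimensional K V] [FiniteDimensional K J] (u : V →ₗ[K] W) (v : V →ₗ[K] J)
    (h : LinearMap.ker v ≤ LinearMap.ker u) :
    Module.finrank K (LinearMap.range u) ≤ Module.finrank K J := by
  have h1 := u.finrank_range_add_finrank_ker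
  have h2 := v.finrank_range_add_finrank_ker
  have h3 := Submodule.finrank_mono h
  have h4 := (LinearMap.range v).finrank_le
  omega

theorem mul_mem_pow_of_jet_eq_zero {r s N : ℕ} {f g : MvPolynomial (Fin 3) K}
    (hN : r + s = N) (hf : (r : ℕ∞) ≤ pointOrder K p q f) (hg : jet K s (chart K p q g) = 0) :
    jet K N (chart K p q (f * g)) = 0 := by
  rw [jet_eq_zero_iff] at hg ⊢
  rw [map_mul, ← hN, pow_add]
  exact Ideal.mul_mem_mul (natCast_le_pointOrder_iff.mp hf) hg

theorem finrank_le_finrank_map_add {V W : Type*} [AddCommGroup V] [Module K V]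
    [AddCommGroup W] [Module K W] [FiniteDimensional K V] (u : V →ₗ[K] W) (S : Submodule K V) :
    Module.finrank K S ≤ Module.finrank K (S.map u) + Module.finrank K (LinearMap.ker u) := by
  have h := (u.domRestrict S).finrank_range_add_finrank_ker
  rw [LinearMap.range_domRestrict] at h
  have h2 : Module.finrank K (LinearMap.ker (u.domRestrict S)) ≤
      Module.finrank K (LinearMap.ker u) := by
    rw [← Submodule.finrank_map_subtype_eq S]
    refine Submodule.finrank_mono ?_
    rintro _ ⟨x, hx, rfl⟩
    simpa using hx
  omega

/-- The Bezout inequality, for degrees that are multiples of `a * b` and `c`. -/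
theorem mul_le_mul_of_isRelPrime_aux (ha : 0 < a) (hb : 0 < b) (hc : 0 < c)
    (hab : Nat.Coprime a b) (hpq : a * q = b * p + 1) {f g : MvPolynomial (Fin 3) K}
    {d e r s : ℕ} (hg0 : g ≠ 0) (hfg : IsRelPrime f g)
    (hf : f.IsWeightedHomogeneous (wt a b c) (a * b * d))
    (hg : g.IsWeightedHomogeneous (wt a b c) (c * e))
    (hr : (r : ℕ∞) ≤ pointOrder K p q f) (hs : (s : ℕ∞) ≤ pointOrder K p q g) :
    r * s ≤ d * e := by
  have hfin := finiteDimensional_weightedHomogeneousSubmodule (a := a) (b := b) (c := c) K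
    ha hb hc
  set N := r + s with hN
  set k := N * (1 + q * c) + (d + c * e) with hk
  have hk1 : N * (1 + q * c) ≤ k := by omega
  have hk2 : a * b * d + c * e ≤ a * b * k := by
    have h1 : a * b * (d + c * e) ≤ a * b * k := Nat.mul_le_mul_left _ (by omega)
    have h2 : 1 * (c * e) ≤ a * b * (c * e) := Nat.mul_le_mul_right _ (Nat.mul_pos ha hb)
    linarith
  obtain ⟨l, hl⟩ := Nat.exists_eq_add_of_le hk2
  set n := a * b * k with hn
  have hn' : n = l + a * b * d + c * e := by omega
  let u := mulHomogeneous f hf (l + c * e) n (by omega)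
  let v := mulHomogeneous g hg (l + a * b * d) n (by omega)
  let u' := mulHomogeneous f hf l (l + a * b * d) (by omega)
  let v' := mulHomogeneous g hg l (l + c * e) (by omega)
  let τ : ∀ M i : ℕ, weightedHomogeneousSubmodule K (wt a b c) i →ₗ[K] (JetIndex M → K) :=
    fun M i => (jet K M).comp ((chart K p q).toLinearMap.comp (Submodule.subtype _))
  -- dimension of the ideal `(f, g)` in degree `n`
  have hker : LinearMap.ker (u.coprod v) ≤ LinearMap.range (v'.prod (-u')) := by
    rintro ⟨A, B⟩ hAB
    have hAB' : f * (A : MvPolynomial (Fin 3) K) + g * B = 0 := by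
      have := congrArg Subtype.val (LinearMap.mem_ker.mp hAB)
      simpa [u, v, coe_mulHomogeneous] using this
    have hdvd : g ∣ f * (A : MvPolynomial (Fin 3) K) := ⟨-B, by linear_combination hAB'⟩
    obtain ⟨C, hC⟩ := hfg.symm.dvd_of_dvd_mul_left hdvd
    have hB : (B : MvPolynomial (Fin 3) K) = -(f * C) :=
      mul_left_cancel₀ hg0 (by rw [hC] at hAB'; linear_combination hAB')
    have hCm : C.IsWeightedHomogeneous (wt a b c) l := by
      by_cases hC0 : C = 0
      · rw [hC0]; exact isWeightedHomogeneous_zero _ _ _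
      · obtain ⟨i, hi, hCi⟩ := exists_isWeightedHomogeneous_of_mul hg0 hC0 hg
          (n := l + c * e) (by rw [← hC]; exact A.2)
        have : i = l := by omega
        exact this ▸ hCi
    refine ⟨⟨C, hCm⟩, Prod.ext (Subtype.ext ?_) (Subtype.ext ?_)⟩
    · simp [v', coe_mulHomogeneous, hC]
    · simp [u', coe_mulHomogeneous, hB]
  have hker' := (Submodule.finrank_mono hker).trans (LinearMap.finrank_range_le _)
  have hrank := (u.coprod v).finrank_range_add_finrank_ker
  rw [Module.finrank_prod] at hrank
  -- its image in the space of jets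
  have hτ : LinearMap.range (τ N n) = ⊤ := by
    rw [LinearMap.range_eq_top]
    intro w
    obtain ⟨F, hF, hw⟩ := exists_jet_chart_eq (K := K) (c := c) hpq hb hk1 w
    exact ⟨⟨F, hF⟩, hw⟩
  have hτrank := (τ N n).finrank_range_add_finrank_ker
  rw [hτ, finrank_top] at hτrank
  have hu : Module.finrank K (LinearMap.range ((τ N n).comp u)) ≤
      Module.finrank K (JetIndex s → K) :=
    finrank_range_le_of_ker_le_ker _ (τ s _) fun A hA =>
      mul_mem_pow_of_jet_eq_zero (g := (A : MvPolynomial (Fin 3) K)) rfl hr hA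
  have hv : Module.finrank K (LinearMap.range ((τ N n).comp v)) ≤
      Module.finrank K (JetIndex r → K) :=
    finrank_range_le_of_ker_le_ker _ (τ r _) fun A hA =>
      mul_mem_pow_of_jet_eq_zero (g := (A : MvPolynomial (Fin 3) K)) (Nat.add_comm s r) hs hA
  have himage := finrank_le_finrank_map_add (τ N n) (LinearMap.range (u.coprod v))
  rw [← LinearMap.range_comp, LinearMap.comp_coprod,
    LinearMap.range_coprod ((τ N n).comp u)] at himage
  have hsum := Submodule.finrank_add_le_finrank_add_finrank
    (LinearMap.range ((τ N n).comp u)) (LinearMap.range ((τ N n).comp v))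
  -- comparison
  have hcount := ncard_weightFiber_add_le (c := c) hab ha hb hc l d e
  simp only [← finrank_weightedHomogeneousSubmodule K] at hcount
  rw [← hn'] at hcount
  have hjN := finrank_jet (K := K) N
  have hjr := finrank_jet (K := K) r
  have hjs := finrank_jet (K := K) s
  have hrs : 2 * (r * s) + (r * (r + 1) + s * (s + 1)) = N * (N + 1) := by rw [hN]; ring
  omega

/-- The Bezout inequality for coprime homogeneous polynomials with prescribed orders of
vanishing. -/
theorem mul_le_mul_of_isRelPrime (ha : 0 < a) (hb : 0 < b) (hc : 0 < c)
    (hab : Nat.Coprime a b) (hpq : a * q = b * p + 1) {f g : MvPolynomial (Fin 3) K}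
    {d e r s : ℕ} (hg0 : g ≠ 0) (hfg : IsRelPrime f g)
    (hf : f.IsWeightedHomogeneous (wt a b c) d) (hg : g.IsWeightedHomogeneous (wt a b c) e)
    (hr : (r : ℕ∞) ≤ pointOrder K p q f) (hs : (s : ℕ∞) ≤ pointOrder K p q g) :
    a * b * c * (r * s) ≤ d * e := by
  have h := mul_le_mul_of_isRelPrime_aux ha hb hc hab hpq (f := f ^ (a * b)) (g := g ^ c)
    (d := d) (e := e) (r := a * b * r) (s := c * s) (pow_ne_zero _ hg0) hfg.pow
    (by simpa using hf.pow (a * b)) (by simpa using hg.pow c)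
    (by rw [pointOrder_pow]; push_cast; gcongr) (by rw [pointOrder_pow]; push_cast; gcongr)
  calc a * b * c * (r * s) = a * b * r * (c * s) := by ring
    _ ≤ d * e := h

end Bezout

section Derivative

variable {K : Type*} [Field K] {a b c p q : ℕ}

theorem pderiv_mem_pow_idealOfVars {σ R : Type*} [CommRing R] {F : MvPolynomial σ R} {r : ℕ}
    (i : σ) (hF : F ∈ idealOfVars σ R ^ (r + 1)) : pderiv i F ∈ idealOfVars σ R ^ r := by
  rw [mem_pow_idealOfVars_iff'] at hF ⊢
  intro m hm
  rw [coeff_pderiv, hF _ (by simpa [Finsupp.degree_single] using hm), zero_mul]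

theorem one_add_X_mul_pderiv_pow {σ R : Type*} [CommRing R] (i : σ) (n : ℕ) :
    (1 + X i) * pderiv i ((1 + X i) ^ n) = (n : MvPolynomial σ R) * (1 + X i) ^ n := by
  rw [pderiv_pow, map_add, pderiv_one, pderiv_X_self, zero_add, mul_one]
  cases n with
  | zero => simp
  | succ n => rw [Nat.add_sub_cancel]; ring

theorem one_add_X_mul_pderiv_zero_chart (f : MvPolynomial (Fin 3) K) :
    (1 + X 0) * pderiv 0 (chart K p q f) =
      (p : MvPolynomial (Fin 2) K) * chart K p q (X 0 * pderiv 0 f) +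
        (q : MvPolynomial (Fin 2) K) * chart K p q (X 1 * pderiv 1 f) := by
  induction f using MvPolynomial.induction_on with
  | C r => simp [MvPolynomial.algebraMap_eq, chart]
  | add f g hf hg =>
    simp only [map_add, mul_add, hf, hg]
    ring
  | mul_X f i hf =>
    have h1 := one_add_X_mul_pderiv_pow (R := K) (0 : Fin 2) p
    have h2 := one_add_X_mul_pderiv_pow (R := K) (0 : Fin 2) q
    simp only [map_mul, Derivation.leibniz, map_add, smul_eq_mul] at hf ⊢
    fin_cases i <;>
    simp only [pderiv_X_self, chart, aeval_X, Matrix.cons_val, Fin.reduceFinMk, Fin.zero_eta,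
      Fin.mk_one, ne_eq, Fin.reduceEq, not_false_eq_true, pderiv_X_of_ne, map_add, map_one,
      map_zero, Fin.isValue, mul_one, mul_zero, pderiv_one, zero_add, one_ne_zero] at hf h1 h2 ⊢
    · linear_combination (1 + X 0) ^ p * hf + aeval ![(1 + X 0) ^ p, (1 + X 0) ^ q, 1 + X 1] f * h1
    · linear_combination (1 + X 0) ^ q * hf + aeval ![(1 + X 0) ^ p, (1 + X 0) ^ q, 1 + X 1] f * h2
    · linear_combination (1 + X 1) * hf

theorem one_add_X_mul_pderiv_one_chart (f : MvPolynomial (Fin 3) K) :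
    (1 + X 1) * pderiv 1 (chart K p q f) = chart K p q (X 2 * pderiv 2 f) := by
  induction f using MvPolynomial.induction_on with
  | C r => simp [MvPolynomial.algebraMap_eq, chart]
  | add f g hf hg =>
    simp only [map_add, mul_add, hf, hg]
  | mul_X f i hf =>
    simp only [map_mul, Derivation.leibniz, map_add, smul_eq_mul] at hf ⊢
    fin_cases i <;>
    simp only [pderiv_X_self, chart, aeval_X, Matrix.cons_val, Fin.reduceFinMk, Fin.zero_eta,
      Fin.mk_one, ne_eq, Fin.reduceEq, not_false_eq_true, pderiv_X_of_ne, map_add, map_one,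
      map_zero, Fin.isValue, mul_one, mul_zero, pderiv_one, zero_add, pderiv_pow, zero_ne_one] at hf ⊢
    · linear_combination (1 + X 0) ^ p * hf
    · linear_combination (1 + X 0) ^ q * hf
    · linear_combination (1 + X 1) * hf

theorem pointOrder_X (i : Fin 3) : pointOrder K p q (X i) = 0 := by
  by_contra h
  rw [pointOrder, ← ne_eq, MvPowerSeries.order_ne_zero_iff_constCoeff_eq_zero,
    ← MvPowerSeries.coeff_zero_eq_constantCoeff_apply, coeff_coe, ← constantCoeff_eq] at h
  fin_cases i <;> simp [chart] at h

theorem le_pointOrder_pderiv (hpq : a * q = b * p + 1) {f : MvPolynomial (Fin 3) K} {d r : ℕ}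
    (hf : f.IsWeightedHomogeneous (wt a b c) d) (hr : ((r + 1 : ℕ) : ℕ∞) ≤ pointOrder K p q f)
    (i : Fin 3) : (r : ℕ∞) ≤ pointOrder K p q (pderiv i f) := by
  suffices h : (r : ℕ∞) ≤ pointOrder K p q (X i * pderiv i f) by
    rwa [pointOrder_mul, pointOrder_X, zero_add] at h
  rw [natCast_le_pointOrder_iff] at hr ⊢
  have hmem : chart K p q f ∈ idealOfVars (Fin 2) K ^ r := Ideal.pow_le_pow_right r.le_succ hr
  have h0 := pderiv_mem_pow_idealOfVars 0 hr
  have h1 := pderiv_mem_pow_idealOfVars 1 hr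
  have e0 := one_add_X_mul_pderiv_zero_chart (p := p) (q := q) f
  have e1 := one_add_X_mul_pderiv_one_chart (p := p) (q := q) f
  have e := congrArg (chart K p q) hf.sum_weight_X_mul_pderiv
  simp only [Fin.sum_univ_three, wt, Matrix.cons_val, nsmul_eq_mul, map_add, map_mul _ (Nat.cast _),
    map_natCast] at e
  have hpq' := congrArg (Nat.cast : ℕ → MvPolynomial (Fin 2) K) hpq
  push_cast at hpq'
  generalize (a : MvPolynomial (Fin 2) K) = a', (b : MvPolynomial (Fin 2) K) = b',
    (c : MvPolynomial (Fin 2) K) = c', (p : MvPolynomial (Fin 2) K) = p',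
    (q : MvPolynomial (Fin 2) K) = q', (d : MvPolynomial (Fin 2) K) = d' at *
  fin_cases i <;> simp only [Fin.reduceFinMk, Fin.zero_eta, Fin.mk_one, Fin.isValue]
  · have : chart K p q (X 0 * pderiv 0 f) = (q' * d') * chart K p q f -
        (q' * c' * (1 + X 1)) * pderiv 1 (chart K p q f) -
        (b' * (1 + X 0)) * pderiv 0 (chart K p q f) := by
      linear_combination q' * e + b' * e0 + (q' * c') * e1 - chart K p q (X 0 * pderiv 0 f) * hpq'
    rw [this]
    exact sub_mem (sub_mem (Ideal.mul_mem_left _ _ hmem) (Ideal.mul_mem_left _ _ h1))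
      (Ideal.mul_mem_left _ _ h0)
  · have : chart K p q (X 1 * pderiv 1 f) = (a' * (1 + X 0)) * pderiv 0 (chart K p q f) -
        (p' * d') * chart K p q f + (p' * c' * (1 + X 1)) * pderiv 1 (chart K p q f) := by
      linear_combination -a' * e0 - (p' * c') * e1 - p' * e - chart K p q (X 1 * pderiv 1 f) * hpq'
    rw [this]
    exact add_mem (sub_mem (Ideal.mul_mem_left _ _ h0) (Ideal.mul_mem_left _ _ hmem))
      (Ideal.mul_mem_left _ _ h1)
  · rw [← e1]
    exact Ideal.mul_mem_left _ _ h1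

end Derivative

section Irreducible

variable {K : Type*} [Field K] {a b c p q : ℕ}

theorem eq_C_of_isWeightedHomogeneous_zero (ha : 0 < a) (hb : 0 < b) (hc : 0 < c)
    {h : MvPolynomial (Fin 3) K} (hh : h.IsWeightedHomogeneous (wt a b c) 0) :
    h = C (coeff 0 h) := by
  ext m
  rw [coeff_C]
  split_ifs with hm
  · rw [hm]
  · by_contra hne
    have := hh hne
    rw [weight_wt] at this
    refine hm (Finsupp.ext fun i => ?_)
    fin_cases i <;> simp <;> nlinarith

/-- A homogeneous polynomial of small degree and large order is divisible by an irreducible one. -/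
theorem dvd_of_mul_lt_mul (ha : 0 < a) (hb : 0 < b) (hc : 0 < c)
    (hab : Nat.Coprime a b) (hpq : a * q = b * p + 1) {f g : MvPolynomial (Fin 3) K}
    {d e r s : ℕ} (hirr : Irreducible f)
    (hf : f.IsWeightedHomogeneous (wt a b c) d) (hg : g.IsWeightedHomogeneous (wt a b c) e)
    (hr : (r : ℕ∞) ≤ pointOrder K p q f) (hs : (s : ℕ∞) ≤ pointOrder K p q g)
    (hlt : d * e < a * b * c * (r * s)) : f ∣ g := by
  by_contra hdvd
  have hg0 : g ≠ 0 := fun h => hdvd (h ▸ dvd_zero f)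
  exact absurd (mul_le_mul_of_isRelPrime ha hb hc hab hpq hg0
    (hirr.isRelPrime_iff_not_dvd.mpr hdvd) hf hg hr hs) (by omega)

/-- An irreducible polynomial whose order exceeds what is needed for being a negative curve has
vanishing partial derivatives. -/
theorem pderiv_eq_zero_of_irreducible (ha : 0 < a) (hb : 0 < b) (hc : 0 < c)
    (hab : Nat.Coprime a b) (hpq : a * q = b * p + 1) {f : MvPolynomial (Fin 3) K}
    {d r : ℕ} (hirr : Irreducible f) (hf : f.IsWeightedHomogeneous (wt a b c) d)
    (hr : ((r + 1 : ℕ) : ℕ∞) ≤ pointOrder K p q f) (hlt : d ^ 2 < a * b * c * r ^ 2)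
    (i : Fin 3) : pderiv i f = 0 := by
  by_contra h0
  obtain ⟨m, hm⟩ := ne_zero_iff.mp h0
  rw [coeff_pderiv] at hm
  have hw : 0 < wt a b c i := by fin_cases i <;> assumption
  have hd := hf (left_ne_zero_of_mul hm)
  rw [map_add, Finsupp.weight_single, one_smul] at hd
  have hpd := hf.pderiv hd
  have hle : (r : ℕ∞) ≤ pointOrder K p q f := le_trans (by exact_mod_cast r.le_succ) hr
  have hmul : d * Finsupp.weight (wt a b c) m ≤ d * d := Nat.mul_le_mul_left _ (by omega)
  obtain ⟨h, hh⟩ := dvd_of_mul_lt_mul ha hb hc hab hpq hirr hf hpd hle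
    (le_pointOrder_pderiv hpq hf hr i) (hmul.trans_lt (by rwa [← sq, ← sq]))
  have hne : h ≠ 0 := by rintro rfl; exact h0 (by rw [hh, mul_zero])
  obtain ⟨e, he, -⟩ := exists_isWeightedHomogeneous_of_mul hirr.ne_zero hne hf (hh ▸ hpd)
  omega

theorem natCast_eq_zero_of_pderiv_eq_zero {σ : Type*} {f : MvPolynomial σ K} {i : σ}
    (h : pderiv i f = 0) {m : σ →₀ ℕ} (hm : coeff m f ≠ 0) : (m i : K) = 0 := by
  by_cases h0 : m i = 0
  · simp [h0]
  · have := congrArg (coeff (m - Finsupp.single i 1)) h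
    have hle : Finsupp.single i 1 ≤ m := by
      rw [Finsupp.single_le_iff]; omega
    rw [coeff_pderiv, tsub_add_cancel_of_le hle, coeff_zero] at this
    have h1 := (mul_eq_zero.mp this).resolve_left hm
    rw [Finsupp.tsub_apply, Finsupp.single_eq_same] at h1
    have h2 : m i = m i - 1 + 1 := by omega
    rw [h2]
    exact_mod_cast h1

/-- Apply an additive map to all coefficients. -/
noncomputable def mapCoeff {σ : Type*} (L : K →+ K) (f : MvPolynomial σ K) : MvPolynomial σ K :=
  ∑ m ∈ f.support, monomial m (L (coeff m f))

theorem coeff_mapCoeff {σ : Type*} (L : K →+ K) (f : MvPolynomial σ K) (m : σ →₀ ℕ) :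
    coeff m (mapCoeff L f) = L (coeff m f) := by
  classical
  simp only [mapCoeff, coeff_sum, coeff_monomial, Finset.sum_ite_eq', mem_support_iff]
  split_ifs with h
  · rfl
  · rw [not_not.mp h, map_zero]

theorem exists_coeff_one_add_pow_eq_natCast (i j : ℕ) (x : Fin 2 →₀ ℕ) :
    ∃ n : ℕ, coeff x ((1 + X 0) ^ i * (1 + X 1) ^ j : MvPolynomial (Fin 2) K) = n := by
  refine ⟨coeff x ((1 + X 0) ^ i * (1 + X 1) ^ j : MvPolynomial (Fin 2) ℕ), ?_⟩
  have := coeff_map (Nat.castRingHom K) ((1 + X 0) ^ i * (1 + X 1) ^ j : MvPolynomial (Fin 2) ℕ) x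
  simpa using this

theorem le_pointOrder_mapCoeff (L : K →+ K) {f : MvPolynomial (Fin 3) K} {r : ℕ}
    (hr : (r : ℕ∞) ≤ pointOrder K p q f) : (r : ℕ∞) ≤ pointOrder K p q (mapCoeff L f) := by
  rw [natCast_le_pointOrder_iff, mem_pow_idealOfVars_iff'] at hr ⊢
  intro x hx
  have h := hr x hx
  rw [f.as_sum, map_sum, coeff_sum] at h
  rw [mapCoeff, map_sum, coeff_sum, ← map_zero L, ← h, map_sum]
  refine Finset.sum_congr rfl fun m _ => ?_
  obtain ⟨n, hn⟩ := exists_coeff_one_add_pow_eq_natCast (K := K) (p * m 0 + q * m 1) (m 2) x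
  rw [chart_monomial, chart_monomial, coeff_C_mul, coeff_C_mul, hn, mul_comm, ← nsmul_eq_mul,
    mul_comm, ← nsmul_eq_mul, map_nsmul]

theorem exists_eq_pow_of_dvd {σ : Type*} {ℓ : ℕ} [Fact ℓ.Prime] [CharP K ℓ]
    {g : MvPolynomial σ K} (hdvd : ∀ m, coeff m g ≠ 0 → ∀ i, ℓ ∣ m i)
    (hfrob : ∀ m, coeff m g ^ ℓ = coeff m g) : ∃ h, g = h ^ ℓ := by
  let h : MvPolynomial σ K :=
    ∑ m ∈ g.support, monomial (m.mapRange (· / ℓ) (Nat.zero_div ℓ)) (coeff m g)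
  have hh : expand ℓ h = g := by
    conv_rhs => rw [g.as_sum]
    rw [map_sum]
    refine Finset.sum_congr rfl fun m hm => ?_
    rw [expand_monomial]
    congr 2
    ext i
    simpa using Nat.mul_div_cancel' (hdvd m (mem_support_iff.mp hm) i)
  refine ⟨h, ?_⟩
  rw [← map_frobenius_expand, hh]
  ext m
  rw [coeff_map, frobenius_def, hfrob]

theorem exists_addMonoidHom_prime_field (ℓ : ℕ) [Fact ℓ.Prime] [CharP K ℓ] :
    ∃ L : K →+ K, L 1 = 1 ∧ ∀ k, L k ^ ℓ = L k := by
  let := ZMod.algebra K ℓ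
  obtain ⟨L, hL⟩ := (Algebra.linearMap (ZMod ℓ) K).exists_leftInverse_of_injective
    (LinearMap.ker_eq_bot.mpr (algebraMap (ZMod ℓ) K).injective)
  refine ⟨((Algebra.linearMap (ZMod ℓ) K).comp L).toAddMonoidHom, ?_, fun k => ?_⟩
  · have := LinearMap.congr_fun hL 1
    simp at this
    simp [this]
  · simp [← map_pow, ZMod.pow_card]

/-- The order of an irreducible negative curve is at most any `r` for which it is negative. -/
theorem not_succ_le_pointOrder_of_irreducible (ha : 0 < a) (hb : 0 < b) (hc : 0 < c)
    (hab : Nat.Coprime a b) (hpq : a * q = b * p + 1) {f : MvPolynomial (Fin 3) K}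
    {d r : ℕ} (hirr : Irreducible f) (hd0 : 0 < d) (hf : f.IsWeightedHomogeneous (wt a b c) d)
    (hlt : d ^ 2 < a * b * c * r ^ 2) : ¬ ((r + 1 : ℕ) : ℕ∞) ≤ pointOrder K p q f := by
  intro hr
  have hzero := fun i => pderiv_eq_zero_of_irreducible ha hb hc hab hpq hirr hf hr hlt i
  obtain ⟨m₀, hm₀⟩ := ne_zero_iff.mp hirr.ne_zero
  obtain ⟨ℓ, hℓ⟩ := CharP.exists K
  have hdvd : ∀ m, coeff m f ≠ 0 → ∀ i, ℓ ∣ m i := fun m hm i =>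
    (CharP.cast_eq_zero_iff K ℓ _).mp (natCast_eq_zero_of_pderiv_eq_zero (hzero i) hm)
  rcases CharP.char_is_prime_or_zero K ℓ with hprime | rfl
  · have : Fact ℓ.Prime := ⟨hprime⟩
    obtain ⟨L, hL1, hL⟩ := exists_addMonoidHom_prime_field (K := K) ℓ
    let g := mapCoeff (L.comp (AddMonoidHom.mulLeft (coeff m₀ f)⁻¹)) f
    have hgc : ∀ m, coeff m g = L ((coeff m₀ f)⁻¹ * coeff m f) := fun m => coeff_mapCoeff _ _ _
    have hgf : ∀ m, coeff m g ≠ 0 → coeff m f ≠ 0 := by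
      intro m hm h
      rw [hgc, h, mul_zero, map_zero] at hm
      exact hm rfl
    have hg0 : g ≠ 0 := by
      refine ne_zero_iff.mpr ⟨m₀, ?_⟩
      rw [hgc, inv_mul_cancel₀ hm₀, hL1]
      exact one_ne_zero
    have hgh : g.IsWeightedHomogeneous (wt a b c) d := fun m hm => hf (hgf m hm)
    have hle : (r : ℕ∞) ≤ pointOrder K p q f := le_trans (by exact_mod_cast r.le_succ) hr
    obtain ⟨u, hu⟩ := dvd_of_mul_lt_mul ha hb hc hab hpq hirr hf hgh hle
      (le_pointOrder_mapCoeff _ hle) (by rwa [← sq, ← sq])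
    have hu0 : u ≠ 0 := by rintro rfl; exact hg0 (by rw [hu, mul_zero])
    obtain ⟨e, he, hue⟩ := exists_isWeightedHomogeneous_of_mul hirr.ne_zero hu0 hf (hu ▸ hgh)
    obtain rfl : e = 0 := by omega
    have hunit : IsUnit u := by
      rw [eq_C_of_isWeightedHomogeneous_zero ha hb hc hue] at hu0 ⊢
      exact (IsUnit.mk0 _ fun h => hu0 (by rw [h, C_0])).map C
    have hgirr : Irreducible g := by
      rw [hu]
      exact (irreducible_mul_isUnit hunit).mpr hirr
    obtain ⟨h, hh⟩ := exists_eq_pow_of_dvd (g := g) (fun m hm => hdvd m (hgf m hm))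
      (fun m => by rw [hgc, hL])
    rw [hh] at hgirr
    exact not_irreducible_pow hprime.ne_one hgirr
  · have hm : m₀ = 0 := Finsupp.ext fun i => Nat.eq_zero_of_zero_dvd (hdvd m₀ hm₀ i)
    have := hf hm₀
    rw [hm, map_zero] at this
    omega

end Irreducible

section Regular

open RingTheory.Sequence
open scoped Pointwise

theorem isRelPrime_of_isRegular {A : Type*} [CommRing A] [IsDomain A] {g₁ g₂ : A}
    (h : IsRegular A [g₁, g₂]) (h0 : g₁ ≠ 0) : IsRelPrime g₁ g₂ := by
  have h2 := ((isWeaklyRegular_cons_iff _ _ _).mp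
    ((isWeaklyRegular_cons_iff _ _ _).mp h.toIsWeaklyRegular).2).1
  intro t ht1 ht2
  obtain ⟨x, hx⟩ := ht1
  obtain ⟨y, hy⟩ := ht2
  have hx0 : x ≠ 0 := by rintro rfl; exact h0 (by rw [hx, mul_zero])
  have hmem : x ∈ g₁ • (⊤ : Submodule A A) := by
    refine mem_of_isSMulRegular_quotient_of_smul_mem h2 ?_
    refine (Submodule.mem_smul_pointwise_iff_exists _ _ _).mpr ⟨y, trivial, ?_⟩
    rw [smul_eq_mul, smul_eq_mul, hx, hy]
    ring
  obtain ⟨z, -, hz⟩ := (Submodule.mem_smul_pointwise_iff_exists _ _ _).mp hmem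
  rw [smul_eq_mul, hx] at hz
  exact IsUnit.of_mul_eq_one z (mul_left_cancel₀ hx0 (by linear_combination hz))

theorem ne_zero_of_isRegular {A : Type*} [CommRing A] [IsDomain A] {g : A} {l : List A}
    (h : IsRegular A (g :: l)) : g ≠ 0 := by
  rintro rfl
  have h1 := ((isWeaklyRegular_cons_iff _ _ _).mp h.toIsWeaklyRegular).1
  exact one_ne_zero (α := A) (h1 (by simp))

end Regular

theorem exists_mul_eq_mul_add_one {a b : ℕ} (ha : 0 < a) (hb : 0 < b) (hab : Nat.Coprime a b) :
    ∃ q p : ℕ, a * q = b * p + 1 := by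
  rcases Nat.lt_or_ge 1 b with h1 | h1
  · obtain ⟨q, hq⟩ := Nat.exists_mul_mod_eq_one_of_coprime hab h1
    exact ⟨q, a * q / b, by have := Nat.div_add_mod (a * q) b; omega⟩
  · obtain rfl : b = 1 := by omega
    exact ⟨1, a - 1, by omega⟩

/-- if `g1, g2` is a regular sequence satisfying Huneke's
condition with `d1/r1 ≤ √(abc) ≤ d2/r2`, and a negative curve
`f ∈ [𝔭^{(r0)}]_{d0}` exists, then `d0/r0 = d1/r1` and `g1 = c·f^n`. -/
theorem statement10 (K : Type*) [Field K] (a b c : ℕ)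
    (ha : 0 < a) (hb : 0 < b) (hc : 0 < c)
    (hab : Nat.Coprime a b) (hbc : Nat.Coprime b c) (hca : Nat.Coprime c a)
    (g1 g2 : MvPolynomial (Fin 3) K) (r1 r2 d1 d2 : ℕ)
    (hr1 : 0 < r1) (hr2 : 0 < r2) (hd1 : 0 < d1) (hd2 : 0 < d2)
    (hreg : RingTheory.Sequence.IsRegular (MvPolynomial (Fin 3) K) [g1, g2])
    (hg1 : g1 ∈ symbPow (pIdeal K a b c) r1)
    (hg1h : g1.IsWeightedHomogeneous (wt a b c) d1)
    (hg2 : g2 ∈ symbPow (pIdeal K a b c) r2)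
    (hg2h : g2.IsWeightedHomogeneous (wt a b c) d2)
    (hHuneke : d1 * d2 = a * b * c * (r1 * r2))
    (hle1 : d1 ^ 2 ≤ a * b * c * r1 ^ 2)
    (hle2 : a * b * c * r2 ^ 2 ≤ d2 ^ 2)
    (f : MvPolynomial (Fin 3) K) (r0 d0 : ℕ) (hr0 : 0 < r0) (hd0 : 0 < d0)
    (hirr : Irreducible f)
    (hf : f ∈ symbPow (pIdeal K a b c) r0)
    (hfh : f.IsWeightedHomogeneous (wt a b c) d0)
    (hneg : d0 ^ 2 < a * b * c * r0 ^ 2) :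
    d0 * r1 = d1 * r0 ∧
    ∃ (n : ℕ) (u : K), 0 < n ∧ u ≠ 0 ∧ g1 = MvPolynomial.C u * f ^ n := by
  obtain ⟨q, p, hpq⟩ : ∃ q p : ℕ, a * q = b * p + 1 := exists_mul_eq_mul_add_one ha hb hab
  have hg10 := ne_zero_of_isRegular hreg
  have hrel := isRelPrime_of_isRegular hreg hg10
  have hof := le_pointOrder_of_mem_symbPow (p := p) (q := q) hf hfh
  have hog1 := le_pointOrder_of_mem_symbPow (p := p) (q := q) hg1 hg1h
  have hog2 := le_pointOrder_of_mem_symbPow (p := p) (q := q) hg2 hg2h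
  have hM : 0 < a * b * c := by positivity
  have horder : pointOrder K p q f = r0 := by
    have := not_succ_le_pointOrder_of_irreducible ha hb hc hab hpq hirr hd0 hfh hneg
    refine le_antisymm ?_ hof
    rw [not_le] at this
    exact Order.le_of_lt_add_one (by exact_mod_cast this)
  have hlt : d0 * d1 < a * b * c * (r0 * r1) := by
    refine lt_of_pow_lt_pow_left₀ 2 (Nat.zero_le _) ?_
    calc (d0 * d1) ^ 2 = d0 ^ 2 * d1 ^ 2 := by ring
      _ < a * b * c * r0 ^ 2 * d1 ^ 2 := Nat.mul_lt_mul_of_pos_right hneg (by positivity)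
      _ ≤ a * b * c * r0 ^ 2 * (a * b * c * r1 ^ 2) := Nat.mul_le_mul_left _ hle1
      _ = (a * b * c * (r0 * r1)) ^ 2 := by ring
  have hfg1 : f ∣ g1 := dvd_of_mul_lt_mul ha hb hc hab hpq hirr hfh hg1h hof hog1 hlt
  have hfg2 : ¬ f ∣ g2 := fun h => hirr.not_isUnit (hrel hfg1 h)
  have hg20 : g2 ≠ 0 := fun h => hfg2 (h ▸ dvd_zero f)
  have slope : ∀ {h : MvPolynomial (Fin 3) K} {e s : ℕ}, IsRelPrime h g2 →
      h.IsWeightedHomogeneous (wt a b c) e → (s : ℕ∞) ≤ pointOrder K p q h →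
      s * d1 ≤ e * r1 := by
    intro h e s hh2 hhe hs
    have := mul_le_mul_of_isRelPrime ha hb hc hab hpq hg20 hh2 hhe hg2h hs hog2
    refine Nat.le_of_mul_le_mul_left (c := a * b * c * r2) ?_ (by positivity)
    calc a * b * c * r2 * (s * d1) = a * b * c * (s * r2) * d1 := by ring
      _ ≤ e * d2 * d1 := Nat.mul_le_mul_right _ this
      _ = e * (d1 * d2) := by ring
      _ = a * b * c * r2 * (e * r1) := by rw [hHuneke]; ring
  have hslope := slope (hirr.isRelPrime_iff_not_dvd.mpr hfg2) hfh hof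
  obtain ⟨h, hgh, hfh'⟩ :=
    (FiniteMultiplicity.of_not_isUnit hirr.not_isUnit hg10).exists_eq_pow_mul_and_not_dvd
  set n := multiplicity f g1 with hn
  have hn0 : 0 < n := by
    rcases Nat.eq_zero_or_pos n with h0 | h0
    · rw [h0, pow_zero, one_mul] at hgh
      exact absurd (hgh ▸ hfg1) hfh'
    · exact h0
  have hh0 : h ≠ 0 := fun h0 => hfh' (h0 ▸ dvd_zero f)
  obtain ⟨e, hde, hhe⟩ := exists_isWeightedHomogeneous_of_mul (pow_ne_zero n hirr.ne_zero) hh0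
    (hfh.pow n) (hgh ▸ hg1h)
  rw [smul_eq_mul] at hde
  rcases le_or_gt r1 (n * r0) with hcase | hcase
  · have h1 : d1 ≤ n * d0 := by
      refine Nat.le_of_mul_le_mul_left (c := r0) ?_ hr0
      calc r0 * d1 ≤ d0 * r1 := hslope
        _ ≤ d0 * (n * r0) := Nat.mul_le_mul_left _ hcase
        _ = r0 * (n * d0) := by ring
    obtain rfl : e = 0 := by omega
    have hhC := eq_C_of_isWeightedHomogeneous_zero ha hb hc hhe
    refine ⟨le_antisymm ?_ (by linarith), n, coeff 0 h, hn0, ?_, ?_⟩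
    · calc d0 * r1 ≤ d0 * (n * r0) := Nat.mul_le_mul_left _ hcase
        _ = d1 * r0 := by rw [hde]; ring
    · intro h0
      exact hh0 (by rw [hhC, h0, C_0])
    · rw [← hhC, mul_comm]
      exact hgh
  · exfalso
    obtain ⟨s, hs⟩ := Nat.exists_eq_add_of_lt hcase
    have hos : ((s + 1 : ℕ) : ℕ∞) ≤ pointOrder K p q h := by
      rw [hgh, pointOrder_mul, pointOrder_pow, horder, hs, add_assoc, Nat.cast_add,
        Nat.cast_mul] at hog1
      exact (ENat.add_le_add_iff_left (by exact_mod_cast ENat.natCast_ne_top (n * r0))).mp hog1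
    have hh2 : IsRelPrime h g2 := fun t ht1 ht2 => hrel (hgh ▸ ht1.mul_left _) ht2
    have h1 := slope hh2 hhe hos
    have h2 := mul_le_mul_of_isRelPrime ha hb hc hab hpq hh0
      (hirr.isRelPrime_iff_not_dvd.mpr hfh') hfh hhe hof hos
    have h3 : e * r1 ≤ (s + 1) * d1 := by
      have h4 := Nat.mul_le_mul_left n hslope
      have h5 : (n * r0 + (s + 1)) * d1 = (n * d0 + e) * r1 := by
        rw [← hde, ← add_assoc, ← hs]; ring
      linarith
    refine absurd ?_ (not_le.mpr hlt)
    refine Nat.le_of_mul_le_mul_left (c := (s + 1) * d1) ?_ (by positivity)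
    calc (s + 1) * d1 * (a * b * c * (r0 * r1)) = a * b * c * (r0 * (s + 1)) * (d1 * r1) := by ring
      _ ≤ d0 * e * (d1 * r1) := Nat.mul_le_mul_right _ h2
      _ = d0 * d1 * (e * r1) := by ring
      _ ≤ d0 * d1 * ((s + 1) * d1) := Nat.mul_le_mul_left _ h3
      _ = (s + 1) * d1 * (d0 * d1) := by ring
end

section
/- Let K be a field, L/K a field extension, and a, b, c pairwise coprime positive integers. Then for all nonnegative integers r and d, the natural map gives [𝔭_K(a,b,c)^{(r)}]_d ⊗_K L = [𝔭_L(a,b,c)^{(r)}]_d; in particular dim_K [𝔭_K(a,b,c)^{(r)}]_d = dim_L [𝔭_L(a,b,c)^{(r)}]_d. -/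
open MvPolynomial

section BaseChange

variable {σ K L : Type*} [Field K] [Field L] [Algebra K L]

/-- Apply a `K`-linear functional `L → K` to all coefficients of a polynomial over `L`. -/
noncomputable def coeffFunctional (σ : Type*) {K L : Type*} [Field K] [Field L] [Algebra K L] (φ : L →ₗ[K] K) :
    MvPolynomial σ L →ₗ[K] MvPolynomial σ K where
  toFun p := AddMonoidAlgebra.map φ.toAddMonoidHom p
  map_add' p q := by
    ext m
    simp only [coeff_addMonoidAlgebraMap, coeff_add, map_add]
  map_smul' k p := by
    ext m
    simp only [coeff_addMonoidAlgebraMap, coeff_smul, RingHom.id_apply, LinearMap.toAddMonoidHom_coe,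
      map_smul]

@[simp]
lemma coeff_coeffFunctional (φ : L →ₗ[K] K) (p : MvPolynomial σ L) (m : σ →₀ ℕ) :
    coeff m (coeffFunctional σ φ p) = φ (coeff m p) := rfl

lemma coeffFunctional_monomial (φ : L →ₗ[K] K) (m : σ →₀ ℕ) (l : L) :
    coeffFunctional σ φ (monomial m l) = monomial m (φ l) := by
  classical
  ext n
  simp only [coeff_coeffFunctional, coeff_monomial]
  split_ifs <;> simp

lemma coeffFunctional_smul_map (φ : L →ₗ[K] K) (l : L) (f : MvPolynomial σ K) :
    coeffFunctional σ φ (l • MvPolynomial.map (algebraMap K L) f) = φ l • f := by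
  ext m
  rw [coeff_coeffFunctional, coeff_smul, coeff_smul, coeff_map, smul_eq_mul, mul_comm,
    ← Algebra.smul_def, map_smul, smul_eq_mul, smul_eq_mul, mul_comm]

lemma coeffFunctional_map_mul (φ : L →ₗ[K] K) (f : MvPolynomial σ K) (p : MvPolynomial σ L) :
    coeffFunctional σ φ (MvPolynomial.map (algebraMap K L) f * p) =
      f * coeffFunctional σ φ p := by
  classical
  ext m
  simp only [coeff_coeffFunctional, coeff_mul, coeff_map, map_sum, ← Algebra.smul_def, map_smul,
    smul_eq_mul]

lemma mem_span_map_iff (W : Submodule K (MvPolynomial σ K)) (g : MvPolynomial σ L) :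
    g ∈ Submodule.span L (MvPolynomial.map (algebraMap K L) '' (W : Set (MvPolynomial σ K))) ↔
      ∀ φ : L →ₗ[K] K, coeffFunctional σ φ g ∈ W := by
  classical
  constructor
  · intro hg φ
    induction hg using Submodule.span_induction generalizing φ with
    | mem x hx =>
      obtain ⟨f, hf, rfl⟩ := hx
      rw [← one_smul L (MvPolynomial.map (algebraMap K L) f), coeffFunctional_smul_map]
      exact W.smul_mem _ hf
    | zero => simp
    | add x y _ _ hx hy => rw [map_add]; exact W.add_mem (hx φ) (hy φ)
    | smul l x _ hx =>
      have : coeffFunctional σ φ (l • x) =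
          coeffFunctional σ (φ ∘ₗ LinearMap.mulLeft K l) x := by
        ext m; simp
      rw [this]
      exact hx _
  · intro h
    let e := Module.Basis.ofVectorSpace K L
    let J := g.support.biUnion fun m => (e.repr (coeff m g)).support
    have hg : g = ∑ j ∈ J, e j •
        MvPolynomial.map (algebraMap K L) (coeffFunctional σ (e.coord j) g) := by
      ext m
      simp only [coeff_sum, coeff_smul, coeff_map, coeff_coeffFunctional]
      by_cases hm : m ∈ g.support
      · conv_lhs => rw [← e.linearCombination_repr (coeff m g), Finsupp.linearCombination_apply]
        rw [Finsupp.sum_of_support_subset _ (s := J)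
          (Finset.subset_biUnion_of_mem (fun m => (e.repr (coeff m g)).support) hm) _ (by simp)]
        refine Finset.sum_congr rfl fun j _ => ?_
        rw [Algebra.smul_def, smul_eq_mul, mul_comm, Module.Basis.coord_apply]
      · simp [notMem_support_iff.mp hm]
    rw [hg]
    exact Submodule.sum_mem _ fun j _ =>
      Submodule.smul_mem _ _ (Submodule.subset_span ⟨_, h _, rfl⟩)

lemma coeffFunctional_mem_of_mem_map (φ : L →ₗ[K] K) (I : Ideal (MvPolynomial σ K))
    {g : MvPolynomial σ L} (hg : g ∈ I.map (MvPolynomial.map (algebraMap K L))) :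
    coeffFunctional σ φ g ∈ I := by
  suffices h : ∀ q, coeffFunctional σ φ (g * q) ∈ I by simpa using h 1
  refine Submodule.span_induction (p := fun g _ => ∀ q, coeffFunctional σ φ (g * q) ∈ I)
    ?_ ?_ ?_ ?_ hg
  · rintro _ ⟨f, hf, rfl⟩ q
    rw [coeffFunctional_map_mul]
    exact I.mul_mem_right _ hf
  · simp
  · intro x y _ _ hx hy q
    rw [add_mul, map_add]
    exact I.add_mem (hx q) (hy q)
  · intro p x _ hx q
    rw [smul_eq_mul, mul_comm p, mul_assoc]
    exact hx _

lemma finrank_span_map (W : Submodule K (MvPolynomial σ K)) :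
    Module.finrank L (Submodule.span L
      (MvPolynomial.map (algebraMap K L) '' (W : Set (MvPolynomial σ K)))) =
      Module.finrank K W := by
  let b := Module.Basis.ofVectorSpace K W
  let v := fun i => MvPolynomial.map (algebraMap K L) (b i : MvPolynomial σ K)
  have hv : LinearIndependent L v := by
    rw [linearIndependent_iff']
    intro s l hl i hi
    rw [← Module.forall_dual_apply_eq_zero_iff K]
    intro φ
    have h := congrArg (coeffFunctional σ φ) hl
    simp only [v, map_sum, coeffFunctional_smul_map, map_zero] at h
    have hb : LinearIndependent K fun i => (b i : MvPolynomial σ K) :=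
      b.linearIndependent.map' W.subtype W.ker_subtype
    exact linearIndependent_iff'.mp hb s (fun i => φ (l i)) h i hi
  have hspan : Submodule.span L (Set.range v) = Submodule.span L
      (MvPolynomial.map (algebraMap K L) '' (W : Set (MvPolynomial σ K))) := by
    refine le_antisymm (Submodule.span_mono ?_) (Submodule.span_le.mpr ?_)
    · rintro _ ⟨i, rfl⟩
      exact ⟨_, (b i).2, rfl⟩
    · rintro _ ⟨f, hf, rfl⟩
      have h : MvPolynomial.map (algebraMap K L) f =
          ∑ i ∈ (b.repr ⟨f, hf⟩).support, algebraMap K L (b.repr ⟨f, hf⟩ i) • v i := by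
        have hf' := congrArg Subtype.val (b.linearCombination_repr ⟨f, hf⟩)
        rw [Finsupp.linearCombination_apply, Finsupp.sum] at hf'
        conv_lhs => rw [← show _ = f from hf']
        simp only [v, smul_eq_C_mul, Submodule.coe_sum, Submodule.coe_smul, map_sum, map_mul, map_C]
      rw [h]
      exact Submodule.sum_mem _ fun i _ =>
        Submodule.smul_mem _ _ (Submodule.subset_span ⟨i, rfl⟩)
  rw [← hspan, Module.finrank_eq_nat_card_basis (Module.Basis.span hv),
    Module.finrank_eq_nat_card_basis b]

end BaseChange

section SymbolicPower

lemma mem_symbPow_iff {A : Type*} [CommRing A] (Q : Ideal A) [Q.IsPrime] (n : ℕ) (f : A) :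
    f ∈ symbPow Q n ↔ ∃ s ∉ Q, s * f ∈ Q ^ n := by
  rw [symbPow, Ideal.mem_comap, IsLocalization.algebraMap_mem_map_algebraMap_iff Q.primeCompl]
  rfl

lemma mul_mem_pow_of_sub_mem {A : Type*} [CommRing A] {Q : Ideal A} {r : ℕ} {s t g : A}
    (hst : s - t ∈ Q) (hs : s * g ∈ Q ^ r) : t ^ r * g ∈ Q ^ r := by
  obtain ⟨u, hu⟩ := sub_dvd_pow_sub_pow t (t - s) r
  have h : t ^ r * g = u * (s * g) + (t - s) ^ r * g := by
    linear_combination g * hu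
  rw [h]
  refine Ideal.add_mem _ (Ideal.mul_mem_left _ _ hs) (Ideal.mul_mem_right _ _ ?_)
  exact Ideal.pow_mem_pow (by rw [← neg_sub]; exact Q.neg_mem hst) r

end SymbolicPower

section SpaceMonomial

variable {K L : Type*} [Field K] [Field L] [Algebra K L] {a b c : ℕ}

lemma toPoly_monomial (m : Fin 3 →₀ ℕ) (k : K) :
    toPoly K a b c (monomial m k) = Polynomial.monomial (Finsupp.weight (wt a b c) m) k := by
  rw [toPoly, aeval_monomial, ← Polynomial.C_mul_X_pow_eq_monomial, Polynomial.algebraMap_eq,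
    Finsupp.weight_apply]
  congr 1
  rw [Finsupp.prod_fintype _ _ (by simp), Finsupp.sum_fintype _ _ (by simp)]
  simp [Fin.prod_univ_three, Fin.sum_univ_three, wt, ← pow_mul, pow_add, mul_comm]

lemma coeff_toPoly_weightedHomogeneousComponent (e n : ℕ) (f : MvPolynomial (Fin 3) K) :
    (toPoly K a b c (weightedHomogeneousComponent (wt a b c) e f)).coeff n =
      if n = e then (toPoly K a b c f).coeff n else 0 := by
  induction f using MvPolynomial.induction_on' with
  | monomial m k =>
    rw [weightedHomogeneousComponent_of_mem (m := e)
      (isWeightedHomogeneous_monomial (wt a b c) m k rfl)]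
    split_ifs <;> simp only [toPoly_monomial, Polynomial.coeff_monomial, map_zero,
      Polynomial.coeff_zero] <;> grind
  | add p q hp hq =>
    simp only [map_add, Polynomial.coeff_add, hp, hq]
    split_ifs <;> simp

lemma toPoly_eq_monomial {e : ℕ} {f : MvPolynomial (Fin 3) K}
    (hf : IsWeightedHomogeneous (wt a b c) f e) :
    toPoly K a b c f = Polynomial.monomial e ((toPoly K a b c f).coeff e) := by
  ext n
  have h := coeff_toPoly_weightedHomogeneousComponent (a := a) (b := b) (c := c) e n f
  rw [hf.weightedHomogeneousComponent_same] at h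
  rw [h, Polynomial.coeff_monomial]
  grind

lemma monomial_notMem_pIdeal (m : Fin 3 →₀ ℕ) : monomial m (1 : K) ∉ pIdeal K a b c := by
  rw [pIdeal, RingHom.mem_ker]
  change toPoly K a b c (monomial m 1) ≠ 0
  simp [toPoly_monomial]

lemma mem_pIdeal {f : MvPolynomial (Fin 3) K} : f ∈ pIdeal K a b c ↔ toPoly K a b c f = 0 :=
  RingHom.mem_ker

attribute [local instance] MvPolynomial.weightedGradedAlgebra

lemma pIdeal_isHomogeneous_s11 :
    (pIdeal K a b c).IsHomogeneous (weightedHomogeneousSubmodule K (wt a b c)) := by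
  intro e f hf
  have h : (DirectSum.decompose (weightedHomogeneousSubmodule K (wt a b c)) f e :
      MvPolynomial (Fin 3) K) = weightedHomogeneousComponent (wt a b c) e f :=
    weightedDecomposition.decompose'_apply K (wt a b c) f e
  rw [h, mem_pIdeal]
  ext n
  rw [coeff_toPoly_weightedHomogeneousComponent, mem_pIdeal.mp hf]
  simp

lemma pIdeal_pow_isHomogeneous (r : ℕ) :
    (pIdeal K a b c ^ r).IsHomogeneous (weightedHomogeneousSubmodule K (wt a b c)) := by
  induction r with
  | zero => rw [pow_zero, Ideal.one_eq_top]; exact Ideal.IsHomogeneous.top _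
  | succ r ih => rw [pow_succ]; exact ih.mul pIdeal_isHomogeneous_s11

lemma exists_homogeneous_mul_mem {r d : ℕ} {g : MvPolynomial (Fin 3) K}
    (hg : IsWeightedHomogeneous (wt a b c) g d) (h : g ∈ symbPow (pIdeal K a b c) r) :
    ∃ e s, IsWeightedHomogeneous (wt a b c) s e ∧ s ∉ pIdeal K a b c ∧
      s * g ∈ pIdeal K a b c ^ r := by
  obtain ⟨s, hs, hsg⟩ := (mem_symbPow_iff _ _ _).mp h
  rw [mem_iff_weightedHomogeneousComponent_mem K (wt a b c) pIdeal_isHomogeneous_s11] at hs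
  push Not at hs
  obtain ⟨e, he⟩ := hs
  refine ⟨e, _, weightedHomogeneousComponent_isWeightedHomogeneous e s, he, ?_⟩
  have h1 := DirectSum.coe_decompose_mul_add_of_right_mem
    (weightedHomogeneousSubmodule K (wt a b c)) (i := e) (a := s) hg
  have h2 := pIdeal_pow_isHomogeneous r (e + d) hsg
  rw [h1] at h2
  exact (weightedDecomposition.decompose'_apply K (wt a b c) s e) ▸ h2

lemma exists_monomial_mul_mem {r d : ℕ} {g : MvPolynomial (Fin 3) K}
    (hg : IsWeightedHomogeneous (wt a b c) g d) (h : g ∈ symbPow (pIdeal K a b c) r) :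
    ∃ m, monomial m 1 * g ∈ pIdeal K a b c ^ r := by
  obtain ⟨e, s, hse, hs, hsg⟩ := exists_homogeneous_mul_mem hg h
  obtain ⟨m, hm⟩ : ∃ m, coeff m s ≠ 0 := by
    refine ne_zero_iff.mp fun h0 => hs ?_
    rw [h0]; exact zero_mem _
  set l := (toPoly K a b c s).coeff e with hl
  have hl0 : l ≠ 0 := fun h0 => hs <| by
    rw [mem_pIdeal, toPoly_eq_monomial hse, ← hl, h0, map_zero]
  have hsub : s - monomial m l ∈ pIdeal K a b c := by
    rw [mem_pIdeal, map_sub, toPoly_eq_monomial hse, toPoly_monomial, hse hm, ← hl, sub_self]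
  have hmem := mul_mem_pow_of_sub_mem hsub hsg
  refine ⟨r • m, ?_⟩
  have h1 : monomial (r • m) 1 * g = C ((l ^ r)⁻¹) * (monomial m l ^ r * g) := by
    rw [monomial_pow, ← mul_assoc, C_mul_monomial, inv_mul_cancel₀ (pow_ne_zero _ hl0)]
  rw [h1]
  exact Ideal.mul_mem_left _ _ hmem

lemma toPoly_map (f : MvPolynomial (Fin 3) K) :
    toPoly L a b c (MvPolynomial.map (algebraMap K L) f) =
      (toPoly K a b c f).map (algebraMap K L) := by
  induction f using MvPolynomial.induction_on' with
  | monomial m k => simp [toPoly_monomial]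
  | add p q hp hq => simp [hp, hq]

lemma coeff_toPoly_coeffFunctional (φ : L →ₗ[K] K) (g : MvPolynomial (Fin 3) L) (n : ℕ) :
    (toPoly K a b c (coeffFunctional (Fin 3) φ g)).coeff n = φ ((toPoly L a b c g).coeff n) := by
  induction g using MvPolynomial.induction_on' with
  | monomial m l =>
    rw [coeffFunctional_monomial, toPoly_monomial, toPoly_monomial, Polynomial.coeff_monomial,
      Polynomial.coeff_monomial]
    split_ifs <;> simp
  | add p q hp hq => simp [hp, hq]

lemma map_mem_pIdeal_iff (f : MvPolynomial (Fin 3) K) :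
    MvPolynomial.map (algebraMap K L) f ∈ pIdeal L a b c ↔ f ∈ pIdeal K a b c := by
  rw [mem_pIdeal, mem_pIdeal, toPoly_map, Polynomial.map_eq_zero]

lemma map_pIdeal :
    (pIdeal K a b c).map (MvPolynomial.map (algebraMap K L)) = pIdeal L a b c := by
  refine le_antisymm (Ideal.map_le_iff_le_comap.mpr fun f hf => ?_) fun g hg => ?_
  · rw [Ideal.mem_comap, map_mem_pIdeal_iff]
    exact hf
  have h : g ∈ Submodule.span L (MvPolynomial.map (algebraMap K L) ''
      ((pIdeal K a b c).restrictScalars K : Set (MvPolynomial (Fin 3) K))) := by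
    rw [mem_span_map_iff]
    intro φ
    rw [Submodule.restrictScalars_mem, mem_pIdeal]
    ext n
    rw [coeff_toPoly_coeffFunctional, mem_pIdeal.mp hg]
    simp
  refine (Submodule.span_le (p := ((pIdeal K a b c).map
    (MvPolynomial.map (algebraMap K L))).restrictScalars L)).mpr ?_ h
  rintro _ ⟨f, hf, rfl⟩
  exact Ideal.mem_map_of_mem _ hf

lemma map_mem_gpiece {r d : ℕ} {f : MvPolynomial (Fin 3) K}
    (hf : f ∈ gpiece K a b c (symbPow (pIdeal K a b c) r) d) :
    MvPolynomial.map (algebraMap K L) f ∈ gpiece L a b c (symbPow (pIdeal L a b c) r) d := by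
  obtain ⟨hf, hd⟩ := hf
  refine ⟨(mem_symbPow_iff _ _ _).mpr ?_, fun m hm => hd (d := m) fun h => hm ?_⟩
  · obtain ⟨s, hs, hsf⟩ := (mem_symbPow_iff _ _ _).mp hf
    refine ⟨MvPolynomial.map (algebraMap K L) s, (map_mem_pIdeal_iff s).not.mpr hs, ?_⟩
    rw [← map_mul, ← map_pIdeal (K := K), ← Ideal.map_pow]
    exact Ideal.mem_map_of_mem _ hsf
  · rw [coeff_map, h, map_zero]

lemma coeffFunctional_mem_gpiece {r d : ℕ} {g : MvPolynomial (Fin 3) L}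
    (hg : g ∈ gpiece L a b c (symbPow (pIdeal L a b c) r) d) (φ : L →ₗ[K] K) :
    coeffFunctional (Fin 3) φ g ∈ gpiece K a b c (symbPow (pIdeal K a b c) r) d := by
  obtain ⟨hg, hd⟩ := hg
  refine ⟨(mem_symbPow_iff _ _ _).mpr ?_, fun m hm => hd (d := m) fun h => hm ?_⟩
  · obtain ⟨m, hm⟩ := exists_monomial_mul_mem hd hg
    refine ⟨monomial m 1, monomial_notMem_pIdeal m, ?_⟩
    rw [← coeffFunctional_map_mul, map_monomial, map_one]
    rw [← map_pIdeal (K := K), ← Ideal.map_pow] at hm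
    exact coeffFunctional_mem_of_mem_map φ _ hm
  · rw [coeff_coeffFunctional, h, map_zero]

end SpaceMonomial

/-- for a field extension `L/K`, base change identifies the graded
pieces of symbolic powers: `[𝔭_K^{(r)}]_d ⊗_K L = [𝔭_L^{(r)}]_d`; in particular
the `K`- and `L`-dimensions agree. -/
theorem statement11 (K L : Type*) [Field K] [Field L] [Algebra K L] (a b c : ℕ)
    (ha : 0 < a) (hb : 0 < b) (hc : 0 < c)
    (hab : Nat.Coprime a b) (hbc : Nat.Coprime b c) (hca : Nat.Coprime c a)
    (r d : ℕ) :
    Submodule.span L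
        (MvPolynomial.map (algebraMap K L) ''
          ((gpiece K a b c (symbPow (pIdeal K a b c) r) d :
            Submodule K (MvPolynomial (Fin 3) K)) : Set (MvPolynomial (Fin 3) K))) =
      gpiece L a b c (symbPow (pIdeal L a b c) r) d ∧
    Module.finrank K (gpiece K a b c (symbPow (pIdeal K a b c) r) d) =
      Module.finrank L (gpiece L a b c (symbPow (pIdeal L a b c) r) d) := by
  have h : Submodule.span L (MvPolynomial.map (algebraMap K L) ''
      ((gpiece K a b c (symbPow (pIdeal K a b c) r) d :
        Submodule K (MvPolynomial (Fin 3) K)) : Set (MvPolynomial (Fin 3) K))) =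
      gpiece L a b c (symbPow (pIdeal L a b c) r) d := by
    refine le_antisymm (Submodule.span_le.mpr ?_) fun g hg =>
      (mem_span_map_iff _ g).mpr (coeffFunctional_mem_gpiece hg)
    rintro _ ⟨f, hf, rfl⟩
    exact map_mem_gpiece hf
  exact ⟨h, by rw [← h, finrank_span_map]⟩
end
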